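/- (Finite stabilization) Fix an o-minimal structure and definable vector fields X₁,…,X_r : ℝⁿ → ℝⁿ. Let E ⊆ ℝⁿ be closed and definable, and define E₀ = E, E_{k+1} = char(E_k). Then there exists k ≤ n+1 such that E_k = E_{k+1} = E_{k+2} = ⋯. -/

import Mathlib

/-- A structure on the ordered field of real numbers: a family of boolean algebras of
subsets of `ℝⁿ`, closed under products and coordinate projections, and containing all
semialgebraic sets (generated by polynomial equalities and inequalities). -/
structure RealStructure where
  defin : (n : ℕ) → Set (Set (Fin n → ℝ))
  empty_mem : ∀ n, ∅ ∈ defin n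
  union_mem : ∀ {n : ℕ} {A B : Set (Fin n → ℝ)}, A ∈ defin n → B ∈ defin n → A ∪ B ∈ defin n
  compl_mem : ∀ {n : ℕ} {A : Set (Fin n → ℝ)}, A ∈ defin n → Aᶜ ∈ defin n
  prod_mem : ∀ {n m : ℕ} {A : Set (Fin n → ℝ)} {B : Set (Fin m → ℝ)},
    A ∈ defin n → B ∈ defin m →
    {x : Fin (n + m) → ℝ | (fun i => x (Fin.castAdd m i)) ∈ A ∧
      (fun i => x (Fin.natAdd n i)) ∈ B} ∈ defin (n + m)
  proj_mem : ∀ {n : ℕ} {A : Set (Fin (n + 1) → ℝ)}, A ∈ defin (n + 1) →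
    {x : Fin n → ℝ | ∃ t : ℝ, Fin.snoc x t ∈ A} ∈ defin n
  polyEq_mem : ∀ {n : ℕ} (p : MvPolynomial (Fin n) ℝ),
    {x : Fin n → ℝ | MvPolynomial.eval x p = 0} ∈ defin n
  polyLt_mem : ∀ {n : ℕ} (p : MvPolynomial (Fin n) ℝ),
    {x : Fin n → ℝ | 0 < MvPolynomial.eval x p} ∈ defin n


/-- An o-minimal structure: a structure on the real field in which every definable
subset of `ℝ` is a finite union of points and open intervals (equivalently, has finite
frontier). -/
structure OMinimalStructure extends RealStructure where
  o_minimal : ∀ {A : Set (Fin 1 → ℝ)}, A ∈ defin 1 →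
    (frontier {t : ℝ | (fun _ : Fin 1 => t) ∈ A}).Finite

/-- A map `f : ℝⁿ → ℝᵐ` is definable if its graph is a definable subset of `ℝ^{n+m}`. -/
def DefinableFun (S : RealStructure) {n m : ℕ} (f : (Fin n → ℝ) → (Fin m → ℝ)) : Prop :=
  {z : Fin (n + m) → ℝ |
    (fun i => z (Fin.natAdd n i)) = f (fun i => z (Fin.castAdd m i))} ∈ S.defin (n + m)

def ZariskiTangent {n : ℕ} (A : Set (Fin n → ℝ)) (p v : Fin n → ℝ) : Prop :=
  ∀ f : (Fin n → ℝ) → ℝ, ContDiff ℝ 1 f → (∀ x ∈ A, f x = 0) → fderiv ℝ f p v = 0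

def charSet {n r : ℕ} (X : Fin r → (Fin n → ℝ) → (Fin n → ℝ)) (A : Set (Fin n → ℝ)) :
    Set (Fin n → ℝ) :=
  {p ∈ A | ∀ j, ZariskiTangent A p (X j p)}

/-- Iterated characteristic sets: `E₀ = E`, `E_{k+1} = char(E_k)`. -/
def iterChar {n r : ℕ} (X : Fin r → (Fin n → ℝ) → (Fin n → ℝ)) (E : Set (Fin n → ℝ)) :
    ℕ → Set (Fin n → ℝ)
  | 0 => E
  | k + 1 => charSet X (iterChar X E k)

/-- A type coordinatized by a power of the real line. -/
class Coord (α : Type) where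
  dim : ℕ
  equiv : α ≃ (Fin dim → ℝ)

instance (n : ℕ) : Coord (Fin n → ℝ) := ⟨n, Equiv.refl _⟩

instance : Coord ℝ := ⟨1, (Equiv.funUnique (Fin 1) ℝ).symm⟩

instance {α β : Type} [Coord α] [Coord β] : Coord (α × β) :=
  ⟨Coord.dim α + Coord.dim β,
    (Equiv.prodCongr Coord.equiv Coord.equiv).trans (Fin.appendEquiv _ _)⟩

namespace RealStructure

variable (S : RealStructure)

theorem univ_mem (n : ℕ) : Set.univ ∈ S.defin n := by
  simpa using S.compl_mem (S.empty_mem n)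

variable {S}

theorem mem_congr {n : ℕ} {A B : Set (Fin n → ℝ)} (hA : A ∈ S.defin n)
    (h : ∀ x, x ∈ B ↔ x ∈ A) : B ∈ S.defin n := by
  rwa [Set.ext h]

theorem inter_mem {n : ℕ} {A B : Set (Fin n → ℝ)} (hA : A ∈ S.defin n) (hB : B ∈ S.defin n) :
    A ∩ B ∈ S.defin n := by
  have := S.compl_mem (S.union_mem (S.compl_mem hA) (S.compl_mem hB))
  simpa [Set.compl_union] using this

theorem iInter_mem {n m : ℕ} {A : Fin m → Set (Fin n → ℝ)} (hA : ∀ i, A i ∈ S.defin n) :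
    (⋂ i, A i) ∈ S.defin n := by
  have key : ∀ s : Finset (Fin m), (⋂ i ∈ s, A i) ∈ S.defin n := by
    intro s
    induction s using Finset.induction_on with
    | empty => simpa using S.univ_mem n
    | insert a s ha ih =>
      rw [Finset.set_biInter_insert]
      exact inter_mem (hA a) ih
  simpa using key Finset.univ

theorem exists_append_mem {n m : ℕ} {A : Set (Fin (n + m) → ℝ)} (hA : A ∈ S.defin (n + m)) :
    {x : Fin n → ℝ | ∃ y : Fin m → ℝ, Fin.append x y ∈ A} ∈ S.defin n := by
  induction m with
  | zero =>
    refine mem_congr hA fun x => ?_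
    simp only [Set.mem_ofPred_eq]
    constructor
    · rintro ⟨y, hy⟩
      have : Fin.append x y = x := by
        rw [Subsingleton.elim y Fin.elim0]; exact Fin.append_elim0 x
      rwa [this] at hy
    · intro h
      refine ⟨Fin.elim0, ?_⟩
      have : Fin.append x (Fin.elim0 : Fin 0 → ℝ) = x := Fin.append_elim0 x
      rwa [this]
  | succ m ih =>
    have h1 := S.proj_mem (n := n + m) hA
    refine mem_congr (ih h1) fun x => ?_
    simp only [Set.mem_ofPred_eq]
    constructor
    · rintro ⟨y, hy⟩
      refine ⟨Fin.init y, y (Fin.last m), ?_⟩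
      rwa [← Fin.append_snoc, Fin.snoc_init_self]
    · rintro ⟨y, t, h⟩
      refine ⟨Fin.snoc y t, ?_⟩
      rwa [Fin.append_snoc]

theorem comp_mem {n m : ℕ} (σ : Fin m → Fin n) {A : Set (Fin m → ℝ)} (hA : A ∈ S.defin m) :
    {x : Fin n → ℝ | x ∘ σ ∈ A} ∈ S.defin n := by
  have h1 := S.prod_mem (S.univ_mem n) hA
  have h2 : (⋂ j : Fin m, {z : Fin (n + m) → ℝ | MvPolynomial.eval z
      (MvPolynomial.X (Fin.natAdd n j) - MvPolynomial.X (Fin.castAdd m (σ j))) = 0}) ∈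
        S.defin (n + m) := iInter_mem fun j => S.polyEq_mem _
  refine mem_congr (exists_append_mem (inter_mem h1 h2)) fun x => ?_
  simp only [Set.mem_ofPred_eq, Set.mem_inter_iff, Set.mem_iInter, map_sub, MvPolynomial.eval_X,
    Fin.append_right, Fin.append_left, Set.mem_univ, true_and]
  constructor
  · intro h
    exact ⟨x ∘ σ, h, fun i => by simp⟩
  · rintro ⟨y, hy, h⟩
    have : x ∘ σ = y := by
      ext i
      have := h i
      simp only [Function.comp]
      linarith
    rwa [this]

end RealStructure

section Definability

open RealStructure

variable {α β γ : Type} [Coord α] [Coord β] [Coord γ] {S : RealStructure}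

/-- Definability of a subset of a coordinatized type. -/
def DefSet (S : RealStructure) (A : Set α) : Prop :=
  Coord.equiv.symm ⁻¹' A ∈ S.defin (Coord.dim α)

/-- Definability of a map between coordinatized types. -/
def DefMap (S : RealStructure) (f : α → β) : Prop :=
  DefSet S {p : α × β | p.2 = f p.1}

theorem DefSet.and {P Q : α → Prop} (hP : DefSet S {a | P a}) (hQ : DefSet S {a | Q a}) :
    DefSet S {a | P a ∧ Q a} := inter_mem hP hQ

theorem DefSet.or {P Q : α → Prop} (hP : DefSet S {a | P a}) (hQ : DefSet S {a | Q a}) :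
    DefSet S {a | P a ∨ Q a} := S.union_mem hP hQ

theorem DefSet.not {P : α → Prop} (hP : DefSet S {a | P a}) :
    DefSet S {a | ¬ P a} := S.compl_mem hP

theorem DefSet.imp {P Q : α → Prop} (hP : DefSet S {a | P a}) (hQ : DefSet S {a | Q a}) :
    DefSet S {a | P a → Q a} := by
  simpa only [imp_iff_not_or] using hP.not.or hQ

theorem DefSet.all {m : ℕ} {P : Fin m → α → Prop} (hP : ∀ i, DefSet S {a | P i a}) :
    DefSet S {a | ∀ i, P i a} := by
  have := iInter_mem hP
  rw [← Set.preimage_iInter] at this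
  exact mem_congr this fun x => by simp

theorem DefSet.ex {P : α → β → Prop} (h : DefSet S {p : α × β | P p.1 p.2}) :
    DefSet S {a | ∃ b, P a b} := by
  refine mem_congr (exists_append_mem h) fun x => ?_
  simp only [Set.mem_preimage, Set.mem_ofPred_eq, Coord.equiv, Fin.appendEquiv]
  simp only [Equiv.symm_trans_apply, Equiv.coe_fn_symm_mk, Equiv.prodCongr_symm,
    Equiv.prodCongr_apply, Prod.map, Fin.append_left, Fin.append_right]
  exact ⟨fun ⟨b, hb⟩ => ⟨Coord.equiv b, by simpa using hb⟩, fun ⟨y, hy⟩ => ⟨_, hy⟩⟩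

theorem DefSet.fa {P : α → β → Prop} (h : DefSet S {p : α × β | P p.1 p.2}) :
    DefSet S {a | ∀ b, P a b} := by
  have := (DefSet.ex (P := fun a b => ¬ P a b) h.not).not
  simpa using this

/-- A map each of whose output coordinates is one of the input coordinates. -/
def IsReindexing (f : α → β) : Prop :=
  ∃ σ : Fin (Coord.dim β) → Fin (Coord.dim α), ∀ a, Coord.equiv (f a) = Coord.equiv a ∘ σ

theorem isReindexing_id : IsReindexing (fun a : α => a) := ⟨id, fun _ => rfl⟩

theorem IsReindexing.fst {f : α → β × γ} (hf : IsReindexing f) :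
    IsReindexing fun a => (f a).1 := by
  obtain ⟨σ, h⟩ := hf
  refine ⟨σ ∘ Fin.castAdd _, fun a => ?_⟩
  rw [← Function.comp_assoc, ← h]
  ext i
  exact (Fin.append_left _ _ _).symm

theorem IsReindexing.snd {f : α → β × γ} (hf : IsReindexing f) :
    IsReindexing fun a => (f a).2 := by
  obtain ⟨σ, h⟩ := hf
  refine ⟨σ ∘ Fin.natAdd _, fun a => ?_⟩
  rw [← Function.comp_assoc, ← h]
  ext i
  exact (Fin.append_right _ _ _).symm

theorem IsReindexing.prodMk {f : α → β} {g : α → γ} (hf : IsReindexing f)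
    (hg : IsReindexing g) : IsReindexing fun a => (f a, g a) := by
  obtain ⟨σ, h⟩ := hf
  obtain ⟨τ, h'⟩ := hg
  refine ⟨Fin.append σ τ, fun a => ?_⟩
  change Fin.append (Coord.equiv (f a)) (Coord.equiv (g a)) = _
  rw [h, h']
  ext i
  refine Fin.addCases (fun i => ?_) (fun i => ?_) i <;> simp

theorem IsReindexing.preimage {f : α → β} (hf : IsReindexing f) {P : β → Prop}
    (hP : DefSet S {b | P b}) : DefSet S {a | P (f a)} := by
  obtain ⟨σ, h⟩ := hf
  refine mem_congr (comp_mem σ hP) fun x => ?_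
  have := h (Coord.equiv.symm x)
  rw [Equiv.apply_symm_apply] at this
  simp [← this]

theorem defSet_diag : DefSet S {p : β × β | p.2 = p.1} := by
  have := iInter_mem (S := S) (fun i : Fin (Coord.dim β) =>
    S.polyEq_mem (n := Coord.dim β + Coord.dim β)
      (MvPolynomial.X (Fin.natAdd _ i) - MvPolynomial.X (Fin.castAdd _ i)))
  refine mem_congr this fun x => ?_
  simp only [Set.mem_preimage, Set.mem_ofPred_eq, Coord.equiv, Fin.appendEquiv, Set.mem_iInter]
  simp only [Equiv.symm_trans_apply, Equiv.coe_fn_symm_mk, Equiv.prodCongr_symm,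
    Equiv.prodCongr_apply, Prod.map, map_sub, MvPolynomial.eval_X, sub_eq_zero,
    EmbeddingLike.apply_eq_iff_eq]
  exact funext_iff

theorem IsReindexing.defMap {f : α → β} (hf : IsReindexing f) : DefMap S f := by
  obtain ⟨σ, h⟩ := hf
  exact IsReindexing.preimage (f := fun p : α × β => (f p.1, p.2))
    (IsReindexing.prodMk ⟨Fin.castAdd _ ∘ σ, fun a => by
      rw [h, ← Function.comp_assoc]
      congr 1
      ext i
      exact (Fin.append_left _ _ _).symm⟩ isReindexing_id.snd)
    (P := fun p : β × β => p.2 = p.1) defSet_diag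

theorem DefMap.preimage {f : α → β} (hf : DefMap S f) {P : β → Prop}
    (hP : DefSet S {b | P b}) : DefSet S {a | P (f a)} := by
  have := DefSet.ex (P := fun a b => b = f a ∧ P b)
    (DefSet.and hf (isReindexing_id.snd.preimage hP))
  simpa using this

theorem DefMap.comp {g : β → γ} {f : α → β} (hg : DefMap S g) (hf : DefMap S f) :
    DefMap S fun a => g (f a) := by
  have h1 : DefSet S {q : (α × γ) × β | q.2 = f q.1.1} :=
    (isReindexing_id.fst.fst.prodMk isReindexing_id.snd).preimage hf
  have h2 : DefSet S {q : (α × γ) × β | q.1.2 = g q.2} :=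
    (isReindexing_id.snd.prodMk isReindexing_id.fst.snd).preimage hg
  have := DefSet.ex (P := fun (p : α × γ) b => b = f p.1 ∧ p.2 = g b) (h1.and h2)
  simpa [DefMap] using this

theorem DefMap.prodMk {f : α → β} {g : α → γ} (hf : DefMap S f) (hg : DefMap S g) :
    DefMap S fun a => (f a, g a) := by
  have h1 : DefSet S {q : α × (β × γ) | q.2.1 = f q.1} :=
    (isReindexing_id.fst.prodMk isReindexing_id.snd.fst).preimage hf
  have h2 : DefSet S {q : α × (β × γ) | q.2.2 = g q.1} :=
    (isReindexing_id.fst.prodMk isReindexing_id.snd.snd).preimage hg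
  have := h1.and h2
  simpa [DefMap, Prod.ext_iff] using this

theorem defMap_id : DefMap S (fun a : α => a) := isReindexing_id.defMap

theorem DefMap.fst {f : α → β × γ} (hf : DefMap S f) : DefMap S fun a => (f a).1 :=
  DefMap.comp (g := fun p : β × γ => p.1) isReindexing_id.fst.defMap hf

theorem DefMap.snd {f : α → β × γ} (hf : DefMap S f) : DefMap S fun a => (f a).2 :=
  DefMap.comp (g := fun p : β × γ => p.2) isReindexing_id.snd.defMap hf

theorem defMap_poly (p : MvPolynomial (Fin (Coord.dim α)) ℝ) :
    DefMap S fun a : α => MvPolynomial.eval (Coord.equiv a) p := by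
  have := S.polyEq_mem (n := Coord.dim α + 1)
    (MvPolynomial.X (Fin.natAdd _ 0) - MvPolynomial.rename (Fin.castAdd 1) p)
  refine mem_congr this fun x => ?_
  simp only [Set.mem_preimage, Set.mem_ofPred_eq, Coord.equiv, Fin.appendEquiv]
  simp [sub_eq_zero, MvPolynomial.eval_rename, Coord.dim]
  rfl

theorem DefMap.apply {n : ℕ} {f : α → Fin n → ℝ} (hf : DefMap S f) (i : Fin n) :
    DefMap S fun a => f a i := by
  refine DefMap.comp (g := fun v : Fin n → ℝ => v i) ?_ hf
  simpa [Coord.equiv] using defMap_poly (S := S) (α := Fin n → ℝ) (MvPolynomial.X i)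

theorem defMap_const (c : ℝ) : DefMap S fun _ : α => c := by
  simpa using defMap_poly (S := S) (α := α) (MvPolynomial.C c)

theorem DefMap.add {f g : α → ℝ} (hf : DefMap S f) (hg : DefMap S g) :
    DefMap S fun a => f a + g a := by
  refine DefMap.comp (g := fun v : ℝ × ℝ => v.1 + v.2) ?_ (hf.prodMk hg)
  have := defMap_poly (S := S) (α := ℝ × ℝ)
    (MvPolynomial.X (Fin.castAdd 1 0) + MvPolynomial.X (Fin.natAdd 1 0))
  simp only [map_add, MvPolynomial.eval_X] at this
  exact this

theorem DefMap.mul {f g : α → ℝ} (hf : DefMap S f) (hg : DefMap S g) :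
    DefMap S fun a => f a * g a := by
  refine DefMap.comp (g := fun v : ℝ × ℝ => v.1 * v.2) ?_ (hf.prodMk hg)
  have := defMap_poly (S := S) (α := ℝ × ℝ)
    (MvPolynomial.X (Fin.castAdd 1 0) * MvPolynomial.X (Fin.natAdd 1 0))
  simp only [map_mul, MvPolynomial.eval_X] at this
  exact this

theorem DefMap.sub {f g : α → ℝ} (hf : DefMap S f) (hg : DefMap S g) :
    DefMap S fun a => f a - g a := by
  simpa [sub_eq_add_neg] using hf.add ((defMap_const (-1)).mul hg)

theorem DefMap.sum {m : ℕ} {f : Fin m → α → ℝ} (hf : ∀ i, DefMap S (f i)) :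
    DefMap S fun a => ∑ i, f i a := by
  have key : ∀ s : Finset (Fin m), DefMap S fun a => ∑ i ∈ s, f i a := by
    intro s
    induction s using Finset.induction_on with
    | empty => simpa using defMap_const 0
    | insert a s ha ih => simpa [Finset.sum_insert ha] using (hf a).add ih
  exact key _

theorem DefSet.eq {f g : α → β} (hf : DefMap S f) (hg : DefMap S g) :
    DefSet S {a | f a = g a} :=
  (hg.prodMk hf).preimage (P := fun p : β × β => p.2 = p.1) defSet_diag

theorem DefSet.lt {f g : α → ℝ} (hf : DefMap S f) (hg : DefMap S g) :
    DefSet S {a | f a < g a} := by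
  have : DefSet S {t : ℝ | 0 < t} := by
    simpa [DefSet, Coord.equiv] using! S.polyLt_mem (n := 1) (MvPolynomial.X 0)
  simpa using (hg.sub hf).preimage this

theorem DefMap.pi {n : ℕ} {f : α → Fin n → ℝ} (hf : ∀ i, DefMap S fun a => f a i) :
    DefMap S f := by
  have := DefSet.all (S := S) (P := fun i (p : α × (Fin n → ℝ)) => p.2 i = f p.1 i)
    fun i => DefSet.eq (defMap_id.snd.apply i) ((hf i).comp defMap_id.fst)
  simpa [DefMap, funext_iff] using this

theorem DefSet.ball {n : ℕ} {f g : α → Fin n → ℝ} {r : α → ℝ} (hf : DefMap S f)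
    (hg : DefMap S g) (hr : DefMap S r) : DefSet S {a | ∀ i, |f a i - g a i| < r a} := by
  simp only [abs_lt]
  refine DefSet.all fun i => DefSet.and ?_ ?_
  · simpa using DefSet.lt ((defMap_const 0).sub hr) ((hf.apply i).sub (hg.apply i))
  · exact DefSet.lt ((hf.apply i).sub (hg.apply i)) hr

end Definability

section Dimension

open Set

variable {S : OMinimalStructure}

theorem DefSet.frontier_finite {A : Set ℝ} (hA : DefSet S.toRealStructure A) :
    (frontier A).Finite := by
  have := S.o_minimal hA
  convert this using 2
  ext t
  exact Iff.rfl

theorem exists_rat_Ioo_subset {U : Set ℝ} (hU : IsOpen U) {x : ℝ} (hx : x ∈ U) :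
    ∃ q q' : ℚ, (q : ℝ) < q' ∧ Ioo (q : ℝ) q' ⊆ U := by
  obtain ⟨ε, hε, h⟩ := Metric.isOpen_iff.1 hU x hx
  obtain ⟨q, hq1, hq2⟩ := exists_rat_btwn (show x - ε < x by linarith)
  obtain ⟨q', hq1', hq2'⟩ := exists_rat_btwn (show x < x + ε by linarith)
  refine ⟨q, q', by linarith, fun y hy => h ?_⟩
  rw [Real.ball_eq_Ioo]
  exact ⟨by linarith [hy.1], by linarith [hy.2]⟩

theorem DefSet.exists_Ioo_of_infinite {A : Set ℝ} (hA : DefSet S.toRealStructure A)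
    (hi : A.Infinite) : ∃ q q' : ℚ, (q : ℝ) < q' ∧ Ioo (q : ℝ) q' ⊆ A := by
  obtain ⟨x, hx, hxf⟩ := (hi.sdiff hA.frontier_finite).nonempty
  have : x ∈ interior A := by
    by_contra h
    exact hxf ⟨subset_closure hx, h⟩
  obtain ⟨q, q', h, h'⟩ := exists_rat_Ioo_subset isOpen_interior this
  exact ⟨q, q', h, h'.trans interior_subset⟩

theorem DefSet.exists_Ioo_subset_or_compl {A : Set ℝ} (hA : DefSet S.toRealStructure A)
    {a b : ℝ} (hab : a < b) :
    ∃ q q' : ℚ, (q : ℝ) < q' ∧ Ioo (q : ℝ) q' ⊆ Ioo a b ∧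
      (Ioo (q : ℝ) q' ⊆ A ∨ Ioo (q : ℝ) q' ⊆ Aᶜ) := by
  obtain ⟨x, hx, hxf⟩ := ((Ioo_infinite hab).sdiff hA.frontier_finite).nonempty
  have : x ∈ interior A ∨ x ∈ interior Aᶜ := by
    rw [interior_compl]
    by_contra! h
    exact hxf ⟨by simpa using h.2, h.1⟩
  rcases this with h | h
  · obtain ⟨q, q', h, h'⟩ := exists_rat_Ioo_subset (isOpen_interior.inter isOpen_Ioo) ⟨h, hx⟩
    exact ⟨q, q', h, h'.trans inter_subset_right,
      .inl (h'.trans (inter_subset_left.trans interior_subset))⟩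
  · obtain ⟨q, q', h, h'⟩ := exists_rat_Ioo_subset (isOpen_interior.inter isOpen_Ioo) ⟨h, hx⟩
    exact ⟨q, q', h, h'.trans inter_subset_right,
      .inr (h'.trans (inter_subset_left.trans interior_subset))⟩

theorem exists_box_subset {d : ℕ} {V : Set (Fin (d + 1) → ℝ)} (hV : IsOpen V)
    (hne : V.Nonempty) : ∃ c : Fin d → ℝ, ∃ ε > 0, ∃ a b : ℝ, a < b ∧
      ∀ x : Fin d → ℝ, (∀ i, |x i - c i| < ε) → ∀ t ∈ Ioo a b,
        (Fin.snoc x t : Fin (d + 1) → ℝ) ∈ V := by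
  obtain ⟨z, hz⟩ := hne
  obtain ⟨ε, hε, h⟩ := Metric.isOpen_iff.1 hV z hz
  refine ⟨fun i => z i.castSucc, ε, hε, z (Fin.last d) - ε, z (Fin.last d) + ε, by linarith,
    fun x hx t ht => h ?_⟩
  rw [Metric.mem_ball, dist_pi_lt_iff hε]
  intro i
  refine Fin.lastCases ?_ (fun i => ?_) i
  · rw [Fin.snoc_last, Real.dist_eq, abs_lt]
    exact ⟨by linarith [ht.1], by linarith [ht.2]⟩
  · rw [Fin.snoc_castSucc, Real.dist_eq]
    exact hx i

theorem interior_nonempty_of_box {d : ℕ} {A : Set (Fin (d + 1) → ℝ)} {W : Set (Fin d → ℝ)}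
    (hW : IsOpen W) (hne : W.Nonempty) {a b : ℝ} (hab : a < b)
    (h : ∀ x ∈ W, ∀ t ∈ Ioo a b, (Fin.snoc x t : Fin (d + 1) → ℝ) ∈ A) :
    (interior A).Nonempty := by
  have ho : IsOpen {z : Fin (d + 1) → ℝ | Fin.init z ∈ W ∧ z (Fin.last d) ∈ Ioo a b} := by
    refine (hW.preimage ?_).inter (isOpen_Ioo.preimage (continuous_apply _))
    exact continuous_pi fun i => continuous_apply _
  obtain ⟨x, hx⟩ := hne
  refine ⟨Fin.snoc x ((a + b) / 2), mem_interior.2 ⟨_, fun z hz => ?_, ho, ?_⟩⟩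
  · rw [← Fin.snoc_init_self z]
    exact h _ hz.1 _ hz.2
  · simp only [mem_ofPred_eq, Fin.init_snoc, Fin.snoc_last, mem_Ioo]
    exact ⟨hx, by linarith, by linarith⟩

theorem isOpen_box {n : ℕ} (c : Fin n → ℝ) (r : ℝ) :
    IsOpen {x : Fin n → ℝ | ∀ i, |x i - c i| < r} := by
  simp only [ofPred_forall]
  exact isOpen_iInter_of_finite fun i => isOpen_lt (by fun_prop) continuous_const

theorem not_subset_iUnion_of_interior_closure_eq_empty {X ι : Type*} [TopologicalSpace X]
    [BaireSpace X] [Countable ι] {W : Set X} (hW : IsOpen W) (hne : W.Nonempty)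
    {f : ι → Set X} (hf : ∀ i, interior (closure (f i)) = ∅) : ¬ W ⊆ ⋃ i, f i := fun h =>
  not_isMeagre_of_isOpen hW hne
    ((isMeagre_iUnion fun i => IsNowhereDense.isMeagre (hf i)).mono h)

theorem defMap_snoc {α : Type} [Coord α] {T : RealStructure} {d : ℕ} {f : α → Fin d → ℝ}
    {g : α → ℝ} (hf : DefMap T f) (hg : DefMap T g) :
    DefMap T fun a => (Fin.snoc (f a) (g a) : Fin (d + 1) → ℝ) := by
  refine DefMap.pi fun i => ?_
  refine Fin.lastCases ?_ (fun i => ?_) i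
  · simpa using hg
  · simpa using hf.apply i

theorem defMap_vec_const {α : Type} [Coord α] {T : RealStructure} {d : ℕ} (c : Fin d → ℝ) :
    DefMap T fun _ : α => c := DefMap.pi fun i => defMap_const (c i)

theorem DefSet.interior_closure_eq_empty {d : ℕ} {A : Set (Fin d → ℝ)}
    (hA : DefSet S.toRealStructure A) (hi : interior A = ∅) : interior (closure A) = ∅ := by
  induction d with
  | zero =>
    have : A = ∅ := by rwa [(isOpen_discrete A).interior_eq] at hi
    simp [this]
  | succ d ih =>
    by_contra hne
    obtain ⟨c, ε, hε, a, b, hab, hbox⟩ :=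
      exists_box_subset isOpen_interior (nonempty_iff_ne_empty.2 hne)
    let W : Set (Fin d → ℝ) := {x | ∀ i, |x i - c i| < ε}
    have hWo : IsOpen W := isOpen_box c ε
    have hWne : W.Nonempty := ⟨c, fun i => by simpa using hε⟩
    let I := {q : ℚ × ℚ // (q.1 : ℝ) < q.2 ∧ Ioo (q.1 : ℝ) q.2 ⊆ Ioo a b}
    let Y : Bool × I → Set (Fin d → ℝ) := fun q => {x | x ∈ W ∧ ∀ t : ℝ, (q.2.1.1 : ℝ) < t ∧
      t < q.2.1.2 → ((Fin.snoc x t : Fin (d + 1) → ℝ) ∈ A ↔ q.1 = true)}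
    have hmem : DefSet S.toRealStructure
        {p : (Fin d → ℝ) × ℝ | (Fin.snoc p.1 p.2 : Fin (d + 1) → ℝ) ∈ A} :=
      (defMap_snoc defMap_id.fst defMap_id.snd).preimage hA
    have hYdef : ∀ q, DefSet S.toRealStructure (Y q) := by
      rintro ⟨s, q⟩
      refine DefSet.and (DefSet.ball defMap_id (defMap_vec_const c) (defMap_const ε))
        (DefSet.fa (DefSet.imp (DefSet.and (DefSet.lt (defMap_const _) defMap_id.snd)
          (DefSet.lt defMap_id.snd (defMap_const _))) ?_))
      cases s
      · simpa using! hmem.not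
      · simpa using! hmem
    have hYint : ∀ q, interior (Y q) = ∅ := by
      rintro ⟨s, q, hq, hqab⟩
      by_contra hne'
      have hne' := nonempty_iff_ne_empty.2 hne'
      cases s
      · have h1 : (interior Aᶜ ∩ closure A).Nonempty := by
          obtain ⟨z, hz⟩ := interior_nonempty_of_box (A := Aᶜ ∩ closure A) isOpen_interior hne' hq
            fun x hx t ht => ⟨fun hxA => by
              simpa using ((interior_subset hx).2 t ht).1 hxA,
              interior_subset (hbox x (interior_subset hx).1 t (hqab ht))⟩
          exact ⟨z, interior_mono inter_subset_left hz, (interior_subset hz).2⟩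
        rw [interior_compl] at h1
        simp at h1
      · have := interior_nonempty_of_box (A := A) isOpen_interior hne' hq
          fun x hx t ht => ((interior_subset hx).2 t ht).2 rfl
        simp [hi] at this
    refine not_subset_iUnion_of_interior_closure_eq_empty hWo hWne
      (fun q => ih (hYdef q) (hYint q)) fun x hx => ?_
    have hfib : DefSet S.toRealStructure {t : ℝ | (Fin.snoc x t : Fin (d + 1) → ℝ) ∈ A} :=
      (defMap_snoc (defMap_vec_const x) defMap_id).preimage hA
    obtain ⟨q, q', hq, hsub, h | h⟩ := hfib.exists_Ioo_subset_or_compl hab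
    · exact mem_iUnion.2 ⟨⟨true, ⟨(q, q'), hq, hsub⟩⟩, hx, fun t ht => by simpa using! h ht⟩
    · exact mem_iUnion.2 ⟨⟨false, ⟨(q, q'), hq, hsub⟩⟩, hx, fun t ht => by simpa using! h ht⟩

/-- A subset of `ℝⁿ` none of whose projections to `d` coordinates has interior. -/
def DimLT {n : ℕ} (d : ℕ) (A : Set (Fin n → ℝ)) : Prop :=
  ∀ σ : Fin d → Fin n, interior ((fun x : Fin n → ℝ => x ∘ σ) '' A) = ∅

theorem DimLT.mono {n d : ℕ} {A B : Set (Fin n → ℝ)} (hB : DimLT d B) (h : A ⊆ B) :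
    DimLT d A := fun σ => by
  rw [← subset_empty_iff, ← hB σ]
  exact interior_mono (image_mono h)

theorem DimLT.eq_empty {n : ℕ} {A : Set (Fin n → ℝ)} (hA : DimLT 0 A) : A = ∅ := by
  have := hA Fin.elim0
  rw [(isOpen_discrete _).interior_eq] at this
  simpa using this

theorem dimLT_succ {n : ℕ} (A : Set (Fin n → ℝ)) : DimLT (n + 1) A := by
  intro σ
  obtain ⟨i, j, hij, h⟩ := Fintype.exists_ne_map_eq_of_card_lt σ (by simp)
  by_contra hne
  obtain ⟨z, hz⟩ := nonempty_iff_ne_empty.2 hne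
  obtain ⟨ε, hε, hb⟩ := Metric.isOpen_iff.1 isOpen_interior z hz
  have hz' : z i = z j := by
    obtain ⟨x, -, rfl⟩ := interior_subset hz
    simp [h]
  have : Function.update z i (z i + ε / 2) ∈ Metric.ball z ε := by
    rw [Metric.mem_ball, dist_pi_lt_iff hε]
    intro k
    by_cases hk : k = i
    · subst hk
      simp [abs_of_pos hε]
      linarith
    · simp [hk, hε]
  obtain ⟨x, -, hx⟩ := interior_subset (hb this)
  have h1 := congrFun hx i
  have h2 := congrFun hx j
  simp [hij.symm, h] at h1 h2
  linarith

theorem defMap_reindex {α : Type} [Coord α] {T : RealStructure} {n d : ℕ} (σ : Fin d → Fin n)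
    {f : α → Fin n → ℝ} (hf : DefMap T f) : DefMap T fun a => f a ∘ σ :=
  DefMap.pi fun i => hf.apply (σ i)

theorem mem_closure_pi_iff {n : ℕ} {A : Set (Fin n → ℝ)} {x : Fin n → ℝ} :
    x ∈ closure A ↔ ∀ ε : ℝ, 0 < ε → ∃ y, y ∈ A ∧ ∀ i, |x i - y i| < ε := by
  rw [Metric.mem_closure_iff]
  refine forall_congr' fun ε => forall_congr' fun hε => exists_congr fun y => ?_
  rw [dist_pi_lt_iff hε]
  simp only [Real.dist_eq]

theorem DefSet.closure {T : RealStructure} {n : ℕ} {A : Set (Fin n → ℝ)} (hA : DefSet T A) :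
    DefSet T (_root_.closure A) := by
  have : _root_.closure A = {x | ∀ ε : ℝ, 0 < ε → ∃ y, y ∈ A ∧ ∀ i, |x i - y i| < ε} := by
    ext x
    exact mem_closure_pi_iff
  rw [this]
  exact DefSet.fa (DefSet.imp (DefSet.lt (defMap_const 0) defMap_id.snd)
    (DefSet.ex (DefSet.and (defMap_id.snd.preimage hA)
      (DefSet.ball defMap_id.fst.fst defMap_id.snd defMap_id.fst.snd))))

theorem exists_rat_box {n : ℕ} {U : Set (Fin n → ℝ)} (hU : IsOpen U) {z : Fin n → ℝ}
    (hz : z ∈ U) : ∃ c : Fin n → ℚ, ∃ r : ℚ, (∀ i, |z i - c i| < r) ∧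
      ∀ x : Fin n → ℝ, (∀ i, |x i - c i| < r) → x ∈ U := by
  obtain ⟨ε, hε, hb⟩ := Metric.isOpen_iff.1 hU z hz
  obtain ⟨r, hr, hr'⟩ := exists_rat_btwn (show (0 : ℝ) < ε / 2 by linarith)
  have : ∀ i, ∃ q : ℚ, |z i - q| < r := fun i => by
    obtain ⟨q, hq, hq'⟩ := exists_rat_btwn (show z i - r < z i by linarith)
    exact ⟨q, abs_lt.2 ⟨by linarith, by linarith⟩⟩
  choose c hc using this
  refine ⟨c, r, hc, fun x hx => hb ?_⟩
  rw [Metric.mem_ball, dist_pi_lt_iff hε]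
  intro i
  have h1 := abs_lt.1 (hc i)
  have h2 := abs_lt.1 (hx i)
  rw [Real.dist_eq, abs_lt]
  exact ⟨by linarith [h1.1, h2.1, h1.2, h2.2], by linarith [h1.1, h2.1, h1.2, h2.2]⟩

theorem DimLT.closure_diff {n d : ℕ} {B : Set (Fin n → ℝ)} (hB : DefSet S.toRealStructure B)
    (hd : DimLT (d + 1) B) : DimLT d (closure B \ B) := by
  intro σ
  by_contra hne
  have hne := nonempty_iff_ne_empty.2 hne
  let I := {q : ℚ × ℚ // (q.1 : ℝ) < q.2}
  let Y : Fin n × I → Set (Fin d → ℝ) := fun q => {x | ∀ t : ℝ, (q.2.1.1 : ℝ) < t ∧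
    t < q.2.1.2 → ∃ b, b ∈ B ∧ b ∘ σ = x ∧ b q.1 = t}
  let Z : (Fin n → ℚ) × ℚ → Set (Fin d → ℝ) := fun q =>
    {x | (∃ z, z ∈ closure B ∧ z ∘ σ = x ∧ ∀ i, |z i - q.1 i| < q.2) ∧
      ¬ ∃ z, z ∈ B ∧ z ∘ σ = x ∧ ∀ i, |z i - q.1 i| < q.2}
  have hYdef : ∀ q, DefSet S.toRealStructure (Y q) := fun q =>
    DefSet.fa (DefSet.imp (DefSet.and (DefSet.lt (defMap_const _) defMap_id.snd)
      (DefSet.lt defMap_id.snd (defMap_const _))) (DefSet.ex (DefSet.and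
        (defMap_id.snd.preimage hB) (DefSet.and
          (DefSet.eq (defMap_reindex σ defMap_id.snd) defMap_id.fst.fst)
          (DefSet.eq (defMap_id.snd.apply _) defMap_id.fst.snd)))))
  have hZ : ∀ (q : (Fin n → ℚ) × ℚ) {C : Set (Fin n → ℝ)}, DefSet S.toRealStructure C →
      DefSet S.toRealStructure
        {x : Fin d → ℝ | ∃ z, z ∈ C ∧ z ∘ σ = x ∧ ∀ i, |z i - q.1 i| < q.2} :=
    fun q C hC => DefSet.ex (DefSet.and (defMap_id.snd.preimage hC) (DefSet.and
      (DefSet.eq (defMap_reindex σ defMap_id.snd) defMap_id.fst)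
      (DefSet.ball defMap_id.snd (defMap_vec_const fun i => (q.1 i : ℝ)) (defMap_const _))))
  have hZdef : ∀ q, DefSet S.toRealStructure (Z q) := fun q =>
    DefSet.and (hZ q hB.closure) (hZ q hB).not
  have hYint : ∀ q, interior (Y q) = ∅ := by
    rintro ⟨j, ⟨q, q'⟩, hq⟩
    by_contra hne'
    have := interior_nonempty_of_box
      (A := (fun x : Fin n → ℝ => x ∘ (Fin.snoc σ j : Fin (d + 1) → Fin n)) '' B)
      isOpen_interior (nonempty_iff_ne_empty.2 hne') hq fun x hx t ht => by
        obtain ⟨b, hb, hbx, hbt⟩ := interior_subset hx t ht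
        refine ⟨b, hb, ?_⟩
        ext i
        refine Fin.lastCases ?_ (fun i => ?_) i
        · simpa using hbt
        · simpa using congrFun hbx i
    simp [hd _] at this
  have hZint : ∀ q, interior (Z q) = ∅ := by
    rintro ⟨c, r⟩
    by_contra hne'
    obtain ⟨x, hx⟩ := nonempty_iff_ne_empty.2 hne'
    obtain ⟨z, hz, hzx, hzr⟩ := (interior_subset hx).1
    have ho : IsOpen ((fun z : Fin n → ℝ => z ∘ σ) ⁻¹' interior (Z (c, r)) ∩
        {z | ∀ i, |z i - c i| < r}) :=
      (isOpen_interior.preimage (continuous_pi fun i => continuous_apply _)).inter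
        (isOpen_box _ _)
    obtain ⟨b, ⟨hb1, hb2⟩, hb⟩ := mem_closure_iff.1 hz _ ho ⟨by simpa [hzx] using hx, hzr⟩
    exact (interior_subset hb1).2 ⟨b, hb, rfl, hb2⟩
  refine not_subset_iUnion_of_interior_closure_eq_empty (f := Sum.elim Y Z) isOpen_interior hne
    (by
      rintro (q | q)
      · exact (hYdef q).interior_closure_eq_empty (hYint q)
      · exact (hZdef q).interior_closure_eq_empty (hZint q)) fun x hx => ?_
  obtain ⟨z, ⟨hz, hzB⟩, rfl⟩ := interior_subset hx
  by_cases hfin : {b | b ∈ B ∧ b ∘ σ = z ∘ σ}.Finite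
  · obtain ⟨c, r, h1, h2⟩ := exists_rat_box hfin.isClosed.isOpen_compl
      (show z ∈ {b | b ∈ B ∧ b ∘ σ = z ∘ σ}ᶜ from fun h => hzB h.1)
    exact mem_iUnion.2 ⟨.inr (c, r), ⟨z, hz, rfl, h1⟩, fun ⟨b, hb, hbσ, hbr⟩ =>
      h2 b hbr ⟨hb, hbσ⟩⟩
  · obtain ⟨j, hj⟩ : ∃ j, ((fun b : Fin n → ℝ => b j) '' {b | b ∈ B ∧ b ∘ σ = z ∘ σ}).Infinite := by
      by_contra! h
      refine hfin ((Finite.pi' (t := fun j => (fun b : Fin n → ℝ => b j) ''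
        {b | b ∈ B ∧ b ∘ σ = z ∘ σ}) fun j => h j).subset ?_)
      exact fun b hb j => ⟨b, hb, rfl⟩
    have hdef : DefSet S.toRealStructure {t : ℝ | ∃ b, (b ∈ B ∧ b ∘ σ = z ∘ σ) ∧ b j = t} :=
      DefSet.ex (DefSet.and (DefSet.and (defMap_id.snd.preimage hB)
        (DefSet.eq (defMap_reindex σ defMap_id.snd) (defMap_vec_const (z ∘ σ))))
          (DefSet.eq (defMap_id.snd.apply _) defMap_id.fst))
    obtain ⟨q, q', hq, hqs⟩ := hdef.exists_Ioo_of_infinite hj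
    refine mem_iUnion.2 ⟨.inl (j, ⟨(q, q'), hq⟩), fun t ht => ?_⟩
    obtain ⟨b, ⟨hb, hbσ⟩, hbj⟩ := hqs ht
    exact ⟨b, hb, hbσ, hbj⟩

end Dimension

section Smoothing

open MeasureTheory Metric

variable {E : Type*} [NormedAddCommGroup E] [NormedSpace ℝ E]

/-- A real function that is bounded on every ball. -/
def BddOnBalls (G : E → ℝ) : Prop := ∀ r, ∃ M, ∀ x, ‖x‖ ≤ r → |G x| ≤ M

variable [FiniteDimensional ℝ E] [MeasurableSpace E] [BorelSpace E]

theorem BddOnBalls.locallyIntegrable {G : E → ℝ} (hG : BddOnBalls G) (hm : Measurable G)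
    (μ : Measure E) [IsLocallyFiniteMeasure μ] : LocallyIntegrable G μ := by
  have : ProperSpace E := FiniteDimensional.proper ℝ E
  rw [locallyIntegrable_iff]
  intro k hk
  obtain ⟨r, hr⟩ := hk.isBounded.exists_norm_le
  obtain ⟨M, hM⟩ := hG r
  refine Measure.integrableOn_of_bounded (M := M) hk.measure_lt_top.ne hm.aestronglyMeasurable ?_
  filter_upwards [ae_restrict_mem hk.measurableSet] with a ha
  exact hM a (hr a ha)

theorem exists_smoothing_unit (E : Type*) [NormedAddCommGroup E] [NormedSpace ℝ E]
    [FiniteDimensional ℝ E] [MeasurableSpace E] [BorelSpace E] :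
    ∃ C : ℝ, 0 ≤ C ∧ ∀ G : E → ℝ, Measurable G → BddOnBalls G →
      ∃ f : E → ℝ, ContDiff ℝ 1 f ∧ ∀ (x : E) (M c : ℝ) (η : E →L[ℝ] ℝ), 0 ≤ M →
        (∀ w, ‖w - x‖ ≤ 1 → |G w - (c + η (w - x))| ≤ M) →
        |f x - c| ≤ M ∧ ‖fderiv ℝ f x - η‖ ≤ C * M := by
  have : ProperSpace E := FiniteDimensional.proper ℝ E
  set μ : Measure E := Measure.addHaar
  let b : ContDiffBump (0 : E) := ⟨1 / 2, 1, by norm_num, by norm_num⟩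
  set ρ : E → ℝ := b.normed μ with hρ
  have hρc : ContDiff ℝ 1 ρ := b.contDiff_normed (n := 1)
  have hρs : HasCompactSupport ρ := b.hasCompactSupport_normed
  have hρi : ∫ t, ρ t ∂μ = 1 := b.integral_normed
  have hts : tsupport ρ = closedBall 0 1 := b.tsupport_normed_eq
  set L := ContinuousLinearMap.mul ℝ ℝ
  have hdc : Continuous (fderiv ℝ ρ) := hρc.continuous_fderiv one_ne_zero
  have hds : HasCompactSupport (fderiv ℝ ρ) := hρs.fderiv (𝕜 := ℝ)
  have hdi : Integrable (fun t => ‖fderiv ℝ ρ t‖) μ :=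
    (hdc.integrable_of_hasCompactSupport hds).norm
  have hρint : Integrable ρ μ := hρc.continuous.integrable_of_hasCompactSupport hρs
  refine ⟨∫ t, ‖fderiv ℝ ρ t‖ ∂μ, integral_nonneg fun _ => norm_nonneg _,
    fun G hGm hGb => ?_⟩
  have hGl := hGb.locallyIntegrable hGm μ
  refine ⟨convolution ρ G L μ, hρs.contDiff_convolution_left (n := 1) L hρc hGl, ?_⟩
  intro x M c η hM hw
  set A : E → ℝ := fun w => c + η (w - x) with hA
  have hAc : Continuous A := by fun_prop
  have hAl : LocallyIntegrable A μ := hAc.locallyIntegrable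
  set R : E → ℝ := fun w => G w - A w with hR
  have hRl : LocallyIntegrable R μ := hGl.sub hAl
  have hconvA : ∀ y, convolution ρ A L μ y = A y := by
    intro y
    have hηc : Integrable (fun t => ρ t * η t) μ :=
      (hρc.continuous.mul η.continuous).integrable_of_hasCompactSupport hρs.mul_right
    have h0 : ∫ t, ρ t * η t ∂μ = 0 := by
      have h1 := integral_neg_eq_self (fun t => ρ t * η t) μ
      have h2 : (fun t => ρ (-t) * η (-t)) = fun t => -(ρ t * η t) := by
        ext t
        rw [hρ, b.normed_neg, map_neg, mul_neg]
      rw [h2, integral_neg] at h1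
      linarith
    rw [convolution_def]
    have h3 : (fun t => L (ρ t) (A (y - t))) = fun t => ρ t * A y - ρ t * η t := by
      ext t
      simp only [L, hA, ContinuousLinearMap.mul_apply', map_sub]
      ring
    rw [h3, integral_sub (hρint.mul_const _) hηc, h0, integral_mul_const, hρi]
    ring
  have hsplit : convolution ρ G L μ = fun y => convolution ρ R L μ y + A y := by
    have h1 : G = R + A := by ext w; simp [hR]
    have := ConvolutionExists.distrib_add (hρs.convolutionExists_left L hρc.continuous hRl)
      (hρs.convolutionExists_left L hρc.continuous hAl)
    rw [← h1] at this
    rw [this]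
    ext y
    rw [Pi.add_apply, hconvA]
  have hRb : ∀ t, t ∈ tsupport ρ → |R (x - t)| ≤ M := by
    intro t ht
    rw [hts, mem_closedBall_zero_iff] at ht
    exact hw (x - t) (by simpa using ht)
  have hval : |convolution ρ R L μ x| ≤ M := by
    rw [convolution_def, ← Real.norm_eq_abs]
    refine (norm_integral_le_of_norm_le (hρint.mul_const M) (.of_forall fun t => ?_)).trans ?_
    · by_cases ht : t ∈ tsupport ρ
      · simp only [L, ContinuousLinearMap.mul_apply', norm_mul]
        rw [Real.norm_eq_abs, abs_of_nonneg (b.nonneg_normed t)]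
        exact mul_le_mul_of_nonneg_left (hRb t ht) (b.nonneg_normed t)
      · simp [image_eq_zero_of_notMem_tsupport ht]
    · rw [integral_mul_const, hρi, one_mul]
  have hder := hρs.hasFDerivAt_convolution_left L hρc hRl x
  have hdn : ‖convolution (fderiv ℝ ρ) R (ContinuousLinearMap.precompL E L) μ x‖ ≤
      (∫ t, ‖fderiv ℝ ρ t‖ ∂μ) * M := by
    rw [convolution_def, ← integral_mul_const]
    refine norm_integral_le_of_norm_le (hdi.mul_const M) (.of_forall fun t => ?_)
    by_cases ht : t ∈ tsupport ρ
    · have h1 : (ContinuousLinearMap.precompL E L (fderiv ℝ ρ t)) (R (x - t))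
          = R (x - t) • fderiv ℝ ρ t := by
        ext v
        simp [L, ContinuousLinearMap.precompL_apply, mul_comm]
      rw [h1, norm_smul, mul_comm]
      exact mul_le_mul_of_nonneg_left (hRb t ht) (norm_nonneg _)
    · have h1 : fderiv ℝ ρ t = 0 :=
        image_eq_zero_of_notMem_tsupport fun h => ht (tsupport_fderiv_subset ℝ h)
      simp [h1]
  have hAd : HasFDerivAt A η x := by
    have h1 : HasFDerivAt (fun w => η (w - x)) η x := by
      exact (η.hasFDerivAt.comp x ((hasFDerivAt_id x).sub_const x)).congr_fderiv (by ext; simp)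
    exact h1.const_add c
  rw [hsplit]
  constructor
  · have : A x = c := by simp [hA]
    simpa [this] using hval
  · rw [(hder.fun_add hAd).fderiv, add_sub_cancel_right]
    exact hdn

theorem exists_smoothing (E : Type*) [NormedAddCommGroup E] [NormedSpace ℝ E]
    [FiniteDimensional ℝ E] [MeasurableSpace E] [BorelSpace E] :
    ∃ C : ℝ, 0 ≤ C ∧ ∀ t : ℝ, 0 < t → ∀ G : E → ℝ, Measurable G → BddOnBalls G →
      ∃ f : E → ℝ, ContDiff ℝ 1 f ∧ ∀ (x : E) (M c : ℝ) (η : E →L[ℝ] ℝ), 0 ≤ M →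
        (∀ w, ‖w - x‖ ≤ t → |G w - (c + η (w - x))| ≤ M) →
        |f x - c| ≤ M ∧ ‖fderiv ℝ f x - η‖ ≤ C * M / t := by
  obtain ⟨C, hC, H⟩ := exists_smoothing_unit E
  refine ⟨C, hC, fun t ht G hGm hGb => ?_⟩
  obtain ⟨f, hf, hfx⟩ := H (fun w => G (t • w)) (hGm.comp (measurable_const_smul t)) (by
    intro r
    obtain ⟨M, hM⟩ := hGb (t * r)
    refine ⟨M, fun x hx => hM _ ?_⟩
    rw [norm_smul, Real.norm_of_nonneg ht.le]
    exact mul_le_mul_of_nonneg_left hx ht.le)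
  refine ⟨fun x => f (t⁻¹ • x), hf.comp (contDiff_const_smul _), ?_⟩
  intro x M c η hM hw
  obtain ⟨h1, h2⟩ := hfx (t⁻¹ • x) M c (t • η) hM (by
    intro w hwx
    have h3 : t • w - x = t • (w - t⁻¹ • x) := by
      rw [smul_sub, smul_smul, mul_inv_cancel₀ ht.ne', one_smul]
    have := hw (t • w) (by
      rw [h3, norm_smul, Real.norm_of_nonneg ht.le]
      nlinarith)
    rw [h3] at this
    simpa using this)
  refine ⟨h1, ?_⟩
  have hd : HasFDerivAt (fun x => f (t⁻¹ • x)) (t⁻¹ • fderiv ℝ f (t⁻¹ • x)) x := by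
    have h4 := (hf.differentiable one_ne_zero (t⁻¹ • x)).hasFDerivAt.comp x
      ((hasFDerivAt_id x).const_smul t⁻¹)
    refine h4.congr_fderiv ?_
    ext v
    simp
  have h5 : t⁻¹ • fderiv ℝ f (t⁻¹ • x) - η = t⁻¹ • (fderiv ℝ f (t⁻¹ • x) - t • η) := by
    rw [smul_sub, smul_smul, inv_mul_cancel₀ ht.ne', one_smul]
  rw [hd.fderiv, h5, norm_smul, norm_inv, Real.norm_of_nonneg ht.le, div_eq_inv_mul]
  exact mul_le_mul_of_nonneg_left h2 (inv_nonneg.2 ht.le)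

end Smoothing

section Gluing

open MeasureTheory Metric Set

variable {E : Type*} [NormedAddCommGroup E] [NormedSpace ℝ E] [FiniteDimensional ℝ E]

theorem exists_cutoff [MeasurableSpace E] [BorelSpace E] (A : Set E) :
    ∃ C : ℝ, 0 ≤ C ∧ ∀ s : ℝ, 0 < s → ∃ θ : E → ℝ, ContDiff ℝ 1 θ ∧ (∀ x, |θ x| ≤ 1) ∧
      (∀ x, ‖fderiv ℝ θ x‖ ≤ C / s) ∧ (∀ x, infDist x A ≤ 2 * s → θ x = 1) ∧
      ∀ x, 4 * s < infDist x A → θ x = 0 := by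
  obtain ⟨C, hC, H⟩ := exists_smoothing E
  refine ⟨C, hC, fun s hs => ?_⟩
  set G : E → ℝ := {x | infDist x A ≤ 3 * s}.indicator 1 with hG
  have hGm : Measurable G := measurable_one.indicator
    (isClosed_le (continuous_infDist_pt A) continuous_const).measurableSet
  have hG1 : ∀ x, |G x| ≤ 1 := by
    intro x
    by_cases h : x ∈ {x | infDist x A ≤ 3 * s}
    · simp [hG, indicator_of_mem h]
    · simp [hG, indicator_of_notMem h]
  obtain ⟨θ, hθ, hx⟩ := H s hs G hGm fun r => ⟨1, fun x _ => hG1 x⟩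
  have hlip : ∀ x w, ‖w - x‖ ≤ s → |infDist w A - infDist x A| ≤ s := by
    intro x w h
    have h1 := infDist_le_infDist_add_dist (s := A) (x := w) (y := x)
    have h2 := infDist_le_infDist_add_dist (s := A) (x := x) (y := w)
    rw [dist_comm x w] at h2
    rw [dist_eq_norm] at h1 h2
    rw [abs_le]
    constructor <;> linarith
  have h0 := fun x => hx x 1 0 0 zero_le_one (fun w _ => by simpa using hG1 w)
  refine ⟨θ, hθ, fun x => by simpa using (h0 x).1, fun x => by simpa using (h0 x).2, ?_, ?_⟩
  · intro x hxs
    have := (hx x 0 1 0 le_rfl fun w hw => ?_).1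
    · exact sub_eq_zero.1 (abs_eq_zero.1 (le_antisymm this (abs_nonneg _)))
    · have h3 := abs_le.1 (hlip x w hw)
      have : w ∈ {x | infDist x A ≤ 3 * s} := by
        rw [mem_ofPred_eq]; linarith [h3.2]
      simp [hG, indicator_of_mem this]
  · intro x hxs
    have := (hx x 0 0 0 le_rfl fun w hw => ?_).1
    · exact sub_eq_zero.1 (abs_eq_zero.1 (le_antisymm this (abs_nonneg _)))
    · have h3 := abs_le.1 (hlip x w hw)
      have : w ∉ {x | infDist x A ≤ 3 * s} := by
        rw [mem_ofPred_eq]; intro h; linarith [h3.1]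
      simp [hG, indicator_of_notMem this]

theorem exists_glue {A : Set E} (hA : IsClosed A) (hne : A.Nonempty) (C₀ : ℝ) (hC₀ : 0 ≤ C₀) :
    ∃ C : ℝ, 0 ≤ C ∧ ∀ f : ℕ → E → ℝ, (∀ k, ContDiff ℝ 1 (f k)) →
      ∃ F : E → ℝ, (∀ x ∈ A, F x = 0) ∧ (∀ x ∉ A, ContDiffAt ℝ 1 F x) ∧
        ∀ (j : ℕ) (x : E) (M c : ℝ) (η : E →L[ℝ] ℝ), 0 ≤ M →
          (1 / 2 : ℝ) ^ (j + 1) < infDist x A → infDist x A ≤ (1 / 2 : ℝ) ^ j →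
          (∀ k, j ≤ k → k ≤ j + 2 →
            |f k x - c| ≤ M ∧ ‖fderiv ℝ (f k) x - η‖ ≤ C₀ * M / (1 / 2 : ℝ) ^ k) →
          |F x - c| ≤ 5 * M ∧ ‖fderiv ℝ F x - η‖ ≤ C * M / (1 / 2 : ℝ) ^ j := by
  borelize E
  obtain ⟨C₁, hC₁, hcut⟩ := exists_cutoff A
  have hs : ∀ k : ℕ, (0 : ℝ) < (1 / 2) ^ k := fun k => by positivity
  choose θ hθ hθ1 hθd hθone hθzero using fun k : ℕ => hcut _ (hs k)
  refine ⟨12 * C₁ + 10 * C₀, by positivity, fun f hf => ?_⟩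
  set FN : ℕ → E → ℝ := fun N x =>
    f 0 x + ∑ k ∈ Finset.range N, θ (k + 1) x * (f (k + 1) x - f k x) with hFN
  have hFNc : ∀ N, ContDiff ℝ 1 (FN N) := fun N =>
    (hf 0).add (ContDiff.sum fun k _ => (hθ _).mul ((hf _).sub (hf _)))
  have hstab : ∀ j x, (1 / 2 : ℝ) ^ (j + 1) < infDist x A →
      ∀ i, FN (j + 2 + i) x = FN (j + 2) x := by
    intro j x hx i
    induction i with
    | zero => rfl
    | succ i ih =>
      rw [← ih]
      simp only [hFN, ← add_assoc, Finset.sum_range_succ]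
      rw [hθzero (j + 2 + i + 1) x, zero_mul, add_zero]
      refine lt_of_le_of_lt ?_ hx
      have h1 : (1 / 2 : ℝ) ^ i ≤ 1 := pow_le_one₀ (by norm_num) (by norm_num)
      have h2 : (1 / 2 : ℝ) ^ (j + 2 + i + 1) = (1 / 2) ^ (j + 1) * (1 / 4) * (1 / 2) ^ i := by
        ring
      rw [h2]
      nlinarith [hs (j + 1)]
  have hpos : ∀ x, x ∉ A → ∃ j : ℕ, (1 / 2 : ℝ) ^ (j + 1) < infDist x A := by
    intro x hx
    obtain ⟨n, hn⟩ := exists_pow_lt_of_lt_one ((hA.notMem_iff_infDist_pos hne).1 hx)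
      (by norm_num : (1 / 2 : ℝ) < 1)
    refine ⟨n, lt_of_le_of_lt ?_ hn⟩
    rw [pow_succ]
    linarith [hs n]
  classical
  set F : E → ℝ := fun x => if h : x ∈ A then 0 else FN ((hpos x h).choose + 2) x with hF
  have hFeq : ∀ j x, (1 / 2 : ℝ) ^ (j + 1) < infDist x A → F x = FN (j + 2) x := by
    intro j x hx
    have hxA : x ∉ A := (hA.notMem_iff_infDist_pos hne).2 ((hs _).trans hx)
    simp only [hF, hxA, dite_false]
    set i := (hpos x hxA).choose with hi
    have hix : (1 / 2 : ℝ) ^ (i + 1) < infDist x A := (hpos x hxA).choose_spec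
    have h1 := hstab j x hx i
    have h2 := hstab i x hix j
    rw [← h1, ← h2]
    congr 1
    ring
  refine ⟨F, fun x hx => by simp [hF, hx], ?_, ?_⟩
  · intro x hx
    obtain ⟨j, hj⟩ := hpos x hx
    refine (hFNc (j + 2)).contDiffAt.congr_of_eventuallyEq ?_
    filter_upwards [(isOpen_lt continuous_const (continuous_infDist_pt A)).mem_nhds hj] with y hy
    exact hFeq j y hy
  · intro j x M c η hM hx1 hx2 hfx
    set H : E → ℝ := fun y => f j y + θ (j + 1) y * (f (j + 1) y - f j y) +
      θ (j + 2) y * (f (j + 2) y - f (j + 1) y) with hH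
    have hFH : ∀ y, (1 / 2 : ℝ) ^ (j + 1) < infDist y A → infDist y A < 2 * (1 / 2 : ℝ) ^ j →
        F y = H y := by
      intro y hy1 hy2
      rw [hFeq j y hy1]
      simp only [hFN, hH, Finset.sum_range_succ]
      have : ∀ k ∈ Finset.range j, θ (k + 1) y * (f (k + 1) y - f k y) = f (k + 1) y - f k y := by
        intro k hk
        rw [hθone (k + 1) y, one_mul]
        refine hy2.le.trans ?_
        have := pow_le_pow_of_le_one (by norm_num : (0 : ℝ) ≤ 1 / 2) (by norm_num)
          (Nat.succ_le_of_lt (Finset.mem_range.1 hk))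
        simp only [Nat.succ_eq_add_one] at this
        linarith
      rw [Finset.sum_congr rfl this, Finset.sum_range_sub (fun k => f k y)]
      ring
    have hx3 : infDist x A < 2 * (1 / 2 : ℝ) ^ j := by linarith [hs j]
    have hev : F =ᶠ[nhds x] H := by
      filter_upwards [(isOpen_lt continuous_const (continuous_infDist_pt A)).mem_nhds hx1,
        (isOpen_lt (continuous_infDist_pt A) continuous_const).mem_nhds hx3] with y h1 h2
      exact hFH y h1 h2
    obtain ⟨a0, b0⟩ := hfx j le_rfl (by lia)
    obtain ⟨a1, b1⟩ := hfx (j + 1) (by lia) (by lia)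
    obtain ⟨a2, b2⟩ := hfx (j + 2) (by lia) le_rfl
    have tri : ∀ {u v : ℝ}, |u - c| ≤ M → |v - c| ≤ M → |u - v| ≤ 2 * M := by
      intro u v h1 h2
      rw [abs_le] at *
      constructor <;> linarith [h1.1, h1.2, h2.1, h2.2]
    have e1 := tri a1 a0
    have e2 := tri a2 a1
    have m1 : |θ (j + 1) x * (f (j + 1) x - f j x)| ≤ 2 * M := by
      rw [abs_mul]
      nlinarith [hθ1 (j + 1) x, abs_nonneg (θ (j + 1) x), abs_nonneg (f (j + 1) x - f j x)]
    have m2 : |θ (j + 2) x * (f (j + 2) x - f (j + 1) x)| ≤ 2 * M := by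
      rw [abs_mul]
      nlinarith [hθ1 (j + 2) x, abs_nonneg (θ (j + 2) x), abs_nonneg (f (j + 2) x - f (j + 1) x)]
    refine ⟨?_, ?_⟩
    · rw [hFH x hx1 hx3]
      simp only [hH]
      rw [abs_le] at *
      constructor <;> linarith [a0.1, a0.2, m1.1, m1.2, m2.1, m2.2]
    · have dif : ∀ {g : E → ℝ}, ContDiff ℝ 1 g → HasFDerivAt g (fderiv ℝ g x) x :=
        fun h => (h.differentiable one_ne_zero x).hasFDerivAt
      have hd := ((dif (hf j)).fun_add ((dif (hθ (j + 1))).fun_mul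
        ((dif (hf (j + 1))).fun_sub (dif (hf j))))).fun_add ((dif (hθ (j + 2))).fun_mul
        ((dif (hf (j + 2))).fun_sub (dif (hf (j + 1)))))
      rw [hev.fderiv_eq, hd.fderiv]
      set D0 := fderiv ℝ (f j) x
      set D1 := fderiv ℝ (f (j + 1)) x
      set D2 := fderiv ℝ (f (j + 2)) x
      set T1 := fderiv ℝ (θ (j + 1)) x with hT1
      set T2 := fderiv ℝ (θ (j + 2)) x with hT2
      have t1 := hθd (j + 1) x
      have t2 := hθd (j + 2) x
      rw [← hT1] at t1
      rw [← hT2] at t2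
      set σ : ℝ := ((1 / 2 : ℝ) ^ j)⁻¹ with hσ
      have hσ0 : 0 < σ := inv_pos.2 (hs j)
      have i1 : ∀ y : ℝ, y / (1 / 2 : ℝ) ^ (j + 1) = 2 * y * σ := by
        intro y; rw [hσ, pow_succ]; field_simp
      have i2 : ∀ y : ℝ, y / (1 / 2 : ℝ) ^ (j + 2) = 4 * y * σ := by
        intro y; rw [hσ, pow_add]; field_simp; norm_num
      rw [i1] at t1 b1
      rw [i2] at t2 b2
      rw [div_eq_mul_inv] at b0 ⊢
      have dtri : ∀ {U V : E →L[ℝ] ℝ}, ‖U - V‖ ≤ ‖U - η‖ + ‖V - η‖ := by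
        intro U V
        have : U - V = (U - η) - (V - η) := by abel
        rw [this]
        exact norm_sub_le _ _
      have hmul : ∀ (a : ℝ) (U : E →L[ℝ] ℝ) (b B : ℝ), |a| ≤ b → ‖U‖ ≤ B → ‖a • U‖ ≤ b * B := by
        intro a U b B h1 h2
        rw [norm_smul]
        exact mul_le_mul h1 h2 (norm_nonneg _) ((abs_nonneg _).trans h1)
      have n1 := hmul _ _ _ _ (hθ1 (j + 1) x) ((dtri (U := D1) (V := D0)).trans (add_le_add b1 b0))
      have n2 := hmul _ _ _ _ (hθ1 (j + 2) x) ((dtri (U := D2) (V := D1)).trans (add_le_add b2 b1))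
      have n3 := hmul _ _ _ _ e1 t1
      have n4 := hmul _ _ _ _ e2 t2
      refine (?_ : _ ≤ ‖D0 - η‖ + ((‖θ (j + 1) x • (D1 - D0)‖ +
        ‖(f (j + 1) x - f j x) • T1‖) + (‖θ (j + 2) x • (D2 - D1)‖ +
        ‖(f (j + 2) x - f (j + 1) x) • T2‖))).trans ?_
      · refine le_trans (le_of_eq (congrArg norm ?_)) ((norm_add_le _ _).trans (add_le_add_right
          ((norm_add_le _ _).trans (add_le_add (norm_add_le _ _) (norm_add_le _ _))) _))
        abel
      · nlinarith
end Gluing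

section Whitney

open MeasureTheory Metric Set

variable {E : Type*} [NormedAddCommGroup E] [NormedSpace ℝ E] [FiniteDimensional ℝ E]

theorem exists_measurable_selection {X Y : Type*} [MeasurableSpace X] [MeasurableSpace Y]
    {f : ℕ → X → Y} {p : ℕ → X → Prop} (hf : ∀ n, Measurable (f n))
    (hp : ∀ n, MeasurableSet {x | p n x}) (hex : ∀ x, ∃ n, p n x) :
    ∃ g : X → Y, Measurable g ∧ ∀ x, ∃ n, p n x ∧ g x = f n x := by
  classical
  exact ⟨_, Measurable.find hf hp hex, fun x => ⟨_, Nat.find_spec (hex x), rfl⟩⟩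

theorem exists_measurable_near_proj [MeasurableSpace E] [BorelSpace E] {A : Set E}
    (hA : IsClosed A) (hne : A.Nonempty) :
    ∃ π : E → E, Measurable π ∧ ∀ w, π w ∈ A ∧ ‖w - π w‖ ≤ 2 * infDist w A := by
  have : ProperSpace E := FiniteDimensional.proper ℝ E
  have := hne.to_subtype
  obtain ⟨u, hu⟩ := TopologicalSpace.exists_dense_seq A
  let f : ℕ → E → E := fun n => Nat.casesOn n id fun m _ => u m
  let p : ℕ → E → Prop := fun n => Nat.casesOn n (fun w => w ∈ A)
    fun m w => dist w (u m) < 2 * infDist w A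
  have hf : ∀ n, Measurable (f n) := by
    rintro (_ | m)
    · exact measurable_id
    · exact measurable_const
  have hp : ∀ n, MeasurableSet {w | p n w} := by
    rintro (_ | m)
    · exact hA.measurableSet
    · exact (isOpen_lt (continuous_id.dist continuous_const)
        (continuous_const.mul (continuous_infDist_pt A))).measurableSet
  have hex : ∀ w, ∃ n, p n w := by
    intro w
    by_cases hw : w ∈ A
    · exact ⟨0, hw⟩
    · have hpos := (hA.notMem_iff_infDist_pos hne).1 hw
      obtain ⟨y, hy, hyd⟩ := (infDist_lt_iff hne).1 (by linarith : infDist w A < 2 * infDist w A)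
      obtain ⟨m, hm⟩ := hu.exists_dist_lt ⟨y, hy⟩ (sub_pos.2 hyd)
      refine ⟨m + 1, ?_⟩
      change dist w (u m) < 2 * infDist w A
      have h1 := dist_triangle w y (u m)
      have h2 : dist y (u m) < 2 * infDist w A - dist w y := hm
      linarith
  obtain ⟨π, hπ, hsel⟩ := exists_measurable_selection hf hp hex
  refine ⟨π, hπ, fun w => ?_⟩
  obtain ⟨n, hn, hw⟩ := hsel w
  have key : ∀ n, p n w → f n w ∈ A ∧ ‖w - f n w‖ ≤ 2 * infDist w A := by
    rintro (_ | m) h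
    · exact ⟨h, by simp [f, infDist_nonneg]⟩
    · refine ⟨(u m).2, ?_⟩
      have h2 : dist w (u m) < 2 * infDist w A := h
      rw [dist_eq_norm] at h2
      exact h2.le
  rw [hw]
  exact key n hn

/-- Whitney's extension theorem of class `C¹` for fields of linear forms over a zero function. -/
theorem whitney_extension {A : Set E} (hA : IsClosed A) (hne : A.Nonempty)
    (ξ : E → E →L[ℝ] ℝ) (hξ : Continuous ξ)
    (hW : ∀ p ∈ A, ∀ ε > 0, ∃ δ > 0, ∀ x ∈ A, ∀ y ∈ A, ‖x - p‖ < δ → ‖y - p‖ < δ →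
      |ξ p (x - y)| ≤ ε * ‖x - y‖) :
    ∃ F : E → ℝ, ContDiff ℝ 1 F ∧ (∀ x ∈ A, F x = 0) ∧ ∀ x ∈ A, fderiv ℝ F x = ξ x := by
  borelize E
  have : ProperSpace E := FiniteDimensional.proper ℝ E
  obtain ⟨π, hπm, hπ⟩ := exists_measurable_near_proj hA hne
  have hdist : ∀ a ∈ A, ∀ w, infDist w A ≤ ‖w - a‖ := fun a ha w => by
    rw [← dist_eq_norm]; exact infDist_le_dist_of_mem ha
  set G : E → ℝ := fun w => ξ (π w) (w - π w) with hG
  have hGm : Measurable G := by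
    have h1 : Continuous fun q : E × E => ξ q.1 (q.2 - q.1) := by fun_prop
    exact h1.measurable.comp (hπm.prodMk measurable_id)
  have hGb : BddOnBalls G := by
    obtain ⟨a, ha⟩ := hne
    intro r
    have hR : ∀ w : E, ‖w‖ ≤ r → ‖w - π w‖ ≤ 2 * (r + ‖a‖) := by
      intro w hw
      have h1 := (hπ w).2
      have h2 := hdist a ha w
      have h3 := norm_sub_le w a
      linarith
    obtain ⟨B, hB⟩ := (isCompact_closedBall (0 : E) (r + 2 * (r + ‖a‖))).exists_bound_of_continuousOn
      hξ.continuousOn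
    refine ⟨B * (2 * (r + ‖a‖)), fun w hw => ?_⟩
    have h1 := hR w hw
    have h2 : π w ∈ closedBall (0 : E) (r + 2 * (r + ‖a‖)) := by
      rw [mem_closedBall_zero_iff]
      have h3 := norm_sub_le w (w - π w)
      rw [sub_sub_cancel] at h3
      linarith
    have h4 := hB _ h2
    rw [← Real.norm_eq_abs]
    exact ((ξ (π w)).le_opNorm _).trans
      (mul_le_mul h4 h1 (norm_nonneg _) ((norm_nonneg _).trans h4))
  have hG1 : ∀ p ∈ A, ∀ ε > 0, ∃ δ > 0, (∀ a, ‖a - p‖ < δ → ‖ξ a - ξ p‖ ≤ ε) ∧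
      ∀ a ∈ A, ∀ w, ‖a - p‖ < δ → ‖w - p‖ < δ →
        |G w - ξ a (w - a)| ≤ ε * ‖w - a‖ := by
    intro p hp ε hε
    obtain ⟨δ₁, hδ₁, h1⟩ := hW p hp (ε / 10) (by positivity)
    obtain ⟨δ₂, hδ₂, h2⟩ := Metric.continuous_iff.1 hξ p (ε / 10) (by positivity)
    set δ := min δ₁ δ₂ with hδ
    have hδ0 : 0 < δ := lt_min hδ₁ hδ₂
    have h2' : ∀ a, ‖a - p‖ < δ → ‖ξ a - ξ p‖ ≤ ε / 10 := by
      intro a ha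
      have := h2 a (by rw [dist_eq_norm]; exact ha.trans_le (min_le_right _ _))
      rw [dist_eq_norm] at this
      exact this.le
    refine ⟨δ / 3, by positivity, fun a ha => (h2' a (by linarith)).trans (by linarith), ?_⟩
    intro a ha w hap hwp
    set b := π w with hb
    have hbA : b ∈ A := (hπ w).1
    have hwb : ‖w - b‖ ≤ 2 * infDist w A := (hπ w).2
    have hwba := hdist a ha w
    have hwbp := hdist p hp w
    have hbp : ‖b - p‖ < δ := by
      have h3 : b - p = (w - p) - (w - b) := by abel
      have h4 := norm_sub_le (w - p) (w - b)
      rw [← h3] at h4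
      linarith
    have hab : ‖a - b‖ ≤ 3 * ‖w - a‖ := by
      have h3 : a - b = (w - b) - (w - a) := by abel
      have h4 := norm_sub_le (w - b) (w - a)
      rw [← h3] at h4
      linarith
    have hap' : ‖a - p‖ < δ := by linarith
    have e1 := h2' a hap'
    have e2 := h2' b hbp
    have e3 := h1 a ha b hbA (hap'.trans_le (min_le_left _ _)) (hbp.trans_le (min_le_left _ _))
    have e4 : ‖ξ b - ξ a‖ ≤ 2 * (ε / 10) := by
      have h3 : ξ b - ξ a = (ξ b - ξ p) - (ξ a - ξ p) := by abel
      have h4 := norm_sub_le (ξ b - ξ p) (ξ a - ξ p)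
      rw [← h3] at h4
      linarith
    have hdec : G w - ξ a (w - a) =
        (ξ b - ξ a) (w - b) + (ξ a - ξ p) (a - b) + ξ p (a - b) := by
      simp only [hG, ← hb, sub_apply, map_sub]
      ring
    have f1 : |(ξ b - ξ a) (w - b)| ≤ 2 * (ε / 10) * (2 * ‖w - a‖) :=
      ((ξ b - ξ a).le_opNorm _).trans (mul_le_mul e4 (by linarith) (norm_nonneg _) (by positivity))
    have f2 : |(ξ a - ξ p) (a - b)| ≤ ε / 10 * (3 * ‖w - a‖) :=
      ((ξ a - ξ p).le_opNorm _).trans (mul_le_mul e1 hab (norm_nonneg _) (by positivity))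
    have f3 : |ξ p (a - b)| ≤ ε / 10 * (3 * ‖w - a‖) :=
      e3.trans (mul_le_mul_of_nonneg_left hab (by positivity))
    rw [hdec]
    refine (abs_add_three _ _ _).trans ?_
    linarith
  obtain ⟨C₀, hC₀, hsm⟩ := exists_smoothing E
  obtain ⟨C, hC, hglue⟩ := exists_glue hA hne C₀ hC₀
  choose f hf hfx using fun k : ℕ =>
    hsm ((1 / 2 : ℝ) ^ k) (by positivity) G hGm hGb
  obtain ⟨F, hF0, hFc, hFx⟩ := hglue f hf
  have hest : ∀ p ∈ A, ∀ ε > 0, ∃ δ > 0, (∀ a, ‖a - p‖ < δ → ‖ξ a - ξ p‖ ≤ ε) ∧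
      ∀ x ∉ A, ‖x - p‖ < δ → ∀ a ∈ A, ‖a - p‖ < δ →
        |F x - ξ a (x - a)| ≤ 15 * ε * ‖x - a‖ ∧
        ‖fderiv ℝ F x - ξ a‖ * infDist x A ≤ C * (3 * ε * ‖x - a‖) := by
    intro p hp ε hε
    obtain ⟨δ, hδ, hξa, hGa⟩ := hG1 p hp ε hε
    refine ⟨min (δ / 4) 1, by positivity, fun a ha => hξa a ?_, ?_⟩
    · have := ha.trans_le (min_le_left _ _); linarith
    intro x hx hxp a ha hap
    have hxp4 := hxp.trans_le (min_le_left _ _)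
    have hap4 := hap.trans_le (min_le_left _ _)
    have hxp1 := hxp.trans_le (min_le_right _ _)
    have hd0 := (hA.notMem_iff_infDist_pos hne).1 hx
    have hdp := hdist p hp x
    have hda := hdist a ha x
    obtain ⟨j, hj1, hj2⟩ := exists_nat_pow_near_of_lt_one hd0 (by linarith)
      (by norm_num : (0 : ℝ) < 1 / 2) (by norm_num)
    have hj3 : (1 / 2 : ℝ) ^ j < 2 * infDist x A := by
      rw [pow_succ] at hj1; linarith
    have hsj : (0 : ℝ) < (1 / 2) ^ j := by positivity
    have key := hFx j x (3 * ε * ‖x - a‖) (ξ a (x - a)) (ξ a) (by positivity) hj1 hj2 (by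
      intro k hk1 hk2
      refine hfx k x _ _ _ (by positivity) fun w hw => ?_
      have hkj : (1 / 2 : ℝ) ^ k ≤ (1 / 2) ^ j :=
        pow_le_pow_of_le_one (by norm_num) (by norm_num) hk1
      have h3 : ‖w - p‖ < δ := by
        have h4 := norm_add_le (w - x) (x - p)
        rw [sub_add_sub_cancel] at h4
        linarith
      have h5 : ‖w - a‖ ≤ 3 * ‖x - a‖ := by
        have h4 := norm_add_le (w - x) (x - a)
        rw [sub_add_sub_cancel] at h4
        linarith
      have h6 := hGa a ha w (by linarith) h3
      have h7 : ξ a (x - a) + ξ a (w - x) = ξ a (w - a) := by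
        rw [← map_add]; congr 1; abel
      rw [h7]
      refine h6.trans ?_
      nlinarith)
    refine ⟨by linarith [key.1], ?_⟩
    have h8 := key.2
    rw [le_div_iff₀ hsj] at h8
    refine le_trans (mul_le_mul_of_nonneg_left hj2 (norm_nonneg _)) h8
  classical
  set D : E → E →L[ℝ] ℝ := fun x => if x ∈ A then ξ x else fderiv ℝ F x with hD
  have hDA : ∀ x ∈ A, D x = ξ x := fun x hx => by simp [hD, hx]
  have hDn : ∀ x ∉ A, D x = fderiv ℝ F x := fun x hx => by simp [hD, hx]
  have hder : ∀ x, HasFDerivAt F (D x) x := by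
    intro p
    by_cases hp : p ∈ A
    · rw [hDA p hp, hasFDerivAt_iff_isLittleO, Asymptotics.isLittleO_iff]
      intro ε hε
      obtain ⟨δ₁, hδ₁, -, h1⟩ := hest p hp (ε / 15) (by positivity)
      obtain ⟨δ₂, hδ₂, h2⟩ := hW p hp ε hε
      filter_upwards [ball_mem_nhds p hδ₁, ball_mem_nhds p hδ₂] with x hx1 hx2
      rw [mem_ball, dist_eq_norm] at hx1 hx2
      rw [hF0 p hp, sub_zero, Real.norm_eq_abs]
      by_cases hx : x ∈ A
      · rw [hF0 x hx, zero_sub, abs_neg]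
        exact h2 x hx p hp hx2 (by simpa using hδ₂)
      · have := (h1 x hx hx1 p hp (by simpa using hδ₁)).1
        linarith
    · rw [hDn p hp]
      exact ((hFc p hp).differentiableAt one_ne_zero).hasFDerivAt
  have hcont : Continuous D := by
    rw [continuous_iff_continuousAt]
    intro p
    by_cases hp : p ∈ A
    · rw [Metric.continuousAt_iff]
      intro ε hε
      obtain ⟨δ, hδ, hξa, h1⟩ := hest p hp (ε / (2 * (6 * C + 1))) (by positivity)
      have hε' : ε / (2 * (6 * C + 1)) * (6 * C + 1) = ε / 2 := by field_simp
      set ε₁ := ε / (2 * (6 * C + 1)) with hε₁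
      have hε₁0 : 0 < ε₁ := by positivity
      refine ⟨δ / 3, by positivity, fun {x} hx => ?_⟩
      rw [dist_eq_norm] at hx ⊢
      rw [hDA p hp]
      by_cases hxA : x ∈ A
      · rw [hDA x hxA]
        have := hξa x (by linarith)
        nlinarith
      · rw [hDn x hxA]
        have hd0 := (hA.notMem_iff_infDist_pos hne).1 hxA
        have hb := (hπ x).2
        have hdp := hdist p hp x
        have hbp : ‖π x - p‖ < δ := by
          have h3 : π x - p = (x - p) - (x - π x) := by abel
          have h4 := norm_sub_le (x - p) (x - π x)
          rw [← h3] at h4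
          linarith
        have h5 := (h1 x hxA (by linarith) (π x) (hπ x).1 hbp).2
        have h6 := hξa (π x) hbp
        have h7 : ‖fderiv ℝ F x - ξ (π x)‖ ≤ 6 * C * ε₁ := by
          have h8 : C * (3 * ε₁ * ‖x - π x‖) ≤ 6 * C * ε₁ * infDist x A := by
            have : 0 ≤ C * (3 * ε₁) := by positivity
            nlinarith
          exact le_of_mul_le_mul_right (h5.trans h8) hd0
        have h9 := norm_add_le (fderiv ℝ F x - ξ (π x)) (ξ (π x) - ξ p)
        rw [sub_add_sub_cancel] at h9
        linarith
    · have h1 : ContinuousAt (fderiv ℝ F) p := (hFc p hp).continuousAt_fderiv one_ne_zero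
      refine h1.congr ?_
      filter_upwards [hA.isOpen_compl.mem_nhds hp] with x hx
      exact (hDn x hx).symm
  refine ⟨F, contDiff_one_iff_hasFDerivAt.2 ⟨D, hcont, hder⟩, hF0, fun x hx => ?_⟩
  rw [(hder x).fderiv, hDA x hx]

end Whitney

section Selection

open Metric Set Filter Topology

/-- Michael's selection theorem. -/
theorem exists_continuous_selection {X V : Type*} [TopologicalSpace X] [NormalSpace X]
    [ParacompactSpace X] [NormedAddCommGroup V] [NormedSpace ℝ V] [CompleteSpace V]
    {B : X → Set V} (hne : ∀ x, (B x).Nonempty) (hcl : ∀ x, IsClosed (B x))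
    (hconv : ∀ x, Convex ℝ (B x))
    (hlsc : ∀ x, ∀ η ∈ B x, ∀ ε > 0, ∀ᶠ y in 𝓝 x, ∃ η' ∈ B y, dist η η' < ε) :
    ∃ g : X → V, Continuous g ∧ ∀ x, g x ∈ B x := by
  have hr : ∀ k : ℕ, (0 : ℝ) < 1 / 2 ^ k := fun k => by positivity
  obtain ⟨g0, hg0⟩ : ∃ g : C(X, V), ∀ x, g x ∈ thickening (1 / 2 ^ 0) (B x) := by
    refine exists_continuous_forall_mem_convex_of_local_const
      (fun x => (hconv x).thickening _) fun x => ?_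
    obtain ⟨η, hη⟩ := hne x
    refine ⟨η, ?_⟩
    filter_upwards [hlsc x η hη _ (hr 0)] with y hy
    exact mem_thickening_iff.2 hy
  have step : ∀ (k : ℕ) (g : C(X, V)), (∀ x, g x ∈ thickening (1 / 2 ^ k) (B x)) →
      ∃ g' : C(X, V), (∀ x, g' x ∈ thickening (1 / 2 ^ (k + 1)) (B x)) ∧
        ∀ x, dist (g x) (g' x) ≤ 2 / 2 / 2 ^ k := by
    intro k g hg
    obtain ⟨g', hg'⟩ : ∃ g' : C(X, V),
        ∀ x, g' x ∈ thickening (1 / 2 ^ (k + 1)) (B x) ∩ ball (g x) (1 / 2 ^ k) := by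
      refine exists_continuous_forall_mem_convex_of_local_const
        (fun x => ((hconv x).thickening _).inter (convex_ball _ _)) fun x => ?_
      obtain ⟨η, hη, hd⟩ := mem_thickening_iff.1 (hg x)
      refine ⟨η, ?_⟩
      have hc : ∀ᶠ y in 𝓝 x, dist (g y) η < 1 / 2 ^ k :=
        (g.continuous.dist continuous_const).continuousAt.eventually_lt_const hd
      filter_upwards [hlsc x η hη _ (hr (k + 1)), hc] with y hy hy'
      exact ⟨mem_thickening_iff.2 hy, by rwa [mem_ball, dist_comm]⟩
    refine ⟨g', fun x => (hg' x).1, fun x => ?_⟩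
    have := (hg' x).2
    rw [mem_ball, dist_comm] at this
    norm_num at this ⊢
    exact this.le
  choose! next hnext1 hnext2 using step
  let g : ℕ → C(X, V) := fun k => Nat.rec g0 next k
  have hg : ∀ k x, g k x ∈ thickening (1 / 2 ^ k) (B x) := by
    intro k
    induction k with
    | zero => exact hg0
    | succ k ih => exact hnext1 k (g k) ih
  have hgd : ∀ x k, dist (g k x) (g (k + 1) x) ≤ 2 / 2 / 2 ^ k :=
    fun x k => hnext2 k (g k) (hg k) x
  choose l hl using fun x => cauchySeq_tendsto_of_complete (cauchySeq_of_le_geometric_two (hgd x))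
  have hdl : ∀ k x, dist (g k x) (l x) ≤ 2 / 2 ^ k :=
    fun k x => dist_le_of_le_geometric_two_of_tendsto (hgd x) (hl x) k
  have hsmall : ∀ ε > (0 : ℝ), ∀ᶠ n : ℕ in atTop, 3 * (1 / 2 : ℝ) ^ n < ε := by
    intro ε hε
    have h1 : Tendsto (fun n : ℕ => 3 * (1 / 2 : ℝ) ^ n) atTop (𝓝 (3 * 0)) :=
      (tendsto_pow_atTop_nhds_zero_of_lt_one (by norm_num) (by norm_num)).const_mul 3
    rw [mul_zero] at h1
    exact h1.eventually_lt_const hε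
  have hhalf : ∀ n : ℕ, (1 / 2 : ℝ) ^ n = 1 / 2 ^ n := fun n => by rw [one_div_pow]
  refine ⟨l, ?_, fun x => ?_⟩
  · have hu : TendstoUniformly (fun k x => g k x) l atTop := by
      rw [Metric.tendstoUniformly_iff]
      intro ε hε
      filter_upwards [hsmall ε hε] with n hn x
      rw [dist_comm]
      refine (hdl n x).trans_lt (lt_of_le_of_lt ?_ hn)
      rw [hhalf, mul_one_div]
      gcongr
      norm_num
    exact hu.continuous (Frequently.of_forall fun k => (g k).continuous)
  · rw [← (hcl x).closure_eq, Metric.mem_closure_iff]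
    intro ε hε
    obtain ⟨n, hn⟩ := (hsmall ε hε).exists
    obtain ⟨z, hz, hzd⟩ := mem_thickening_iff.1 (hg n x)
    refine ⟨z, hz, ?_⟩
    have h1 := dist_triangle_left (l x) z (g n x)
    have h2 := hdl n x
    rw [hhalf, mul_one_div] at hn
    have h3 : (3 : ℝ) / 2 ^ n = 2 / 2 ^ n + 1 / 2 ^ n := by ring
    linarith

end Selection

section Bundles

open Metric Set Filter Topology Module

variable {X E : Type*} [TopologicalSpace X] [NormedAddCommGroup E]

theorem eventually_notMem_of_notMem_closure {W : Set (X × E)} {p : X} {K : Set E}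
    (hK : IsCompact K) (h : ∀ w ∈ K, (p, w) ∉ closure W) :
    ∀ᶠ x in 𝓝 p, ∀ w ∈ K, (x, w) ∉ W := by
  refine hK.eventually_forall_of_forall_eventually fun w hw => ?_
  filter_upwards [isClosed_closure.isOpen_compl.mem_nhds (h w hw)] with z hz hzW
  exact hz (subset_closure hzW)

variable [NormedSpace ℝ E]

/-- The total space of a field of linear subspaces. -/
def totalSpace (H : X → Submodule ℝ E) : Set (X × E) := {q | q.2 ∈ H q.1}

/-- The field spanned by the fibres of the closure of the total space. -/
def linearClosure (H : X → Submodule ℝ E) (x : X) : Submodule ℝ E :=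
  Submodule.span ℝ {v | (x, v) ∈ closure (totalSpace H)}

theorem le_linearClosure (H : X → Submodule ℝ E) (x : X) : H x ≤ linearClosure H x :=
  fun _ hv => Submodule.subset_span (subset_closure hv)

theorem linearClosure_congr {H H' : X → Submodule ℝ E} {x : X} (h : H =ᶠ[𝓝 x] H') :
    linearClosure H x = linearClosure H' x := by
  have key : ∀ {H H' : X → Submodule ℝ E}, H =ᶠ[𝓝 x] H' →
      linearClosure H x ≤ linearClosure H' x := by
    intro H H' h
    refine Submodule.span_mono fun v hv => ?_
    rw [mem_ofPred_eq, mem_closure_iff_frequently] at hv ⊢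
    have h2 : ∀ᶠ q : X × E in 𝓝 (x, v), H q.1 = H' q.1 :=
      (continuous_fst.tendsto (x, v)).eventually h
    refine (hv.and_eventually h2).mono fun q hq => ?_
    have h3 : q.2 ∈ H q.1 := hq.1
    rw [hq.2] at h3
    exact h3
  exact le_antisymm (key h) (key h.symm)

variable [FiniteDimensional ℝ E]

theorem eventually_abs_le_of_closure {W : Set (X × E)}
    (hW : ∀ x w, (x, w) ∈ W → ∀ t : ℝ, (x, t • w) ∈ W) {p : X} {η : E →L[ℝ] ℝ}
    (hη : ∀ v, (p, v) ∈ closure W → η v = 0) {ε : ℝ} (hε : 0 < ε) :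
    ∀ᶠ x in 𝓝 p, ∀ w, (x, w) ∈ W → |η w| ≤ ε * ‖w‖ := by
  have : ProperSpace E := FiniteDimensional.proper ℝ E
  have hK : IsCompact (sphere (0 : E) 1 ∩ {w | ε ≤ |η w|}) :=
    (isCompact_sphere _ _).inter_right (isClosed_le continuous_const η.continuous.abs)
  have := eventually_notMem_of_notMem_closure (W := W) (p := p) hK fun w hw hcl => by
    have h1 : ε ≤ |η w| := hw.2
    rw [hη w hcl, abs_zero] at h1
    linarith
  filter_upwards [this] with x hx w hw
  by_contra! hlt
  have hw0 : w ≠ 0 := by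
    rintro rfl
    simp at hlt
  have hn : 0 < ‖w‖ := norm_pos_iff.2 hw0
  refine hx (‖w‖⁻¹ • w) ⟨?_, ?_⟩ (hW x w hw _)
  · rw [mem_sphere_zero_iff_norm, norm_smul, norm_inv, norm_norm, inv_mul_cancel₀ hn.ne']
  · rw [mem_ofPred_eq, map_smul, smul_eq_mul, abs_mul, abs_of_pos (inv_pos.2 hn),
      inv_mul_eq_div, le_div_iff₀ hn]
    exact hlt.le

theorem eventually_finrank_le (H : X → Submodule ℝ E) (x : X) :
    ∀ᶠ y in 𝓝 x, finrank ℝ (H y) ≤ finrank ℝ (linearClosure H x) := by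
  have : ProperSpace E := FiniteDimensional.proper ℝ E
  obtain ⟨C, hC⟩ := Submodule.exists_isCompl (linearClosure H x)
  have hK : IsCompact (sphere (0 : E) 1 ∩ C) :=
    (isCompact_sphere _ _).inter_right C.closed_of_finiteDimensional
  have := eventually_notMem_of_notMem_closure (W := totalSpace H) (p := x) hK fun w hw hcl => by
    have h1 : w ∈ linearClosure H x := Submodule.subset_span hcl
    have h2 := (Submodule.disjoint_def.1 hC.disjoint) w h1 hw.2
    have h3 := hw.1
    rw [mem_sphere_zero_iff_norm, h2, norm_zero] at h3
    exact zero_ne_one h3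
  filter_upwards [this] with y hy
  have hd : Disjoint (H y) C := by
    rw [Submodule.disjoint_def]
    intro w hw hwC
    by_contra hw0
    have hn : 0 < ‖w‖ := norm_pos_iff.2 hw0
    refine hy (‖w‖⁻¹ • w) ⟨?_, C.smul_mem _ hwC⟩ ((H y).smul_mem _ hw)
    rw [mem_sphere_zero_iff_norm, norm_smul, norm_inv, norm_norm, inv_mul_cancel₀ hn.ne']
  have h1 := Submodule.finrank_add_finrank_le_of_disjoint hd
  have h2 := Submodule.finrank_add_eq_of_isCompl hC
  lia

/-- Glaeser's iteration stabilizes. -/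
theorem iterate_linearClosure_stable (H : X → Submodule ℝ E) :
    linearClosure (linearClosure^[2 * (finrank ℝ E + 1)] H) =
      linearClosure^[2 * (finrank ℝ E + 1)] H := by
  set B : ℕ → X → Submodule ℝ E := fun i => linearClosure^[i] H with hB
  have hsucc : ∀ i, B (i + 1) = linearClosure (B i) := fun i =>
    Function.iterate_succ_apply' _ _ _
  have key : ∀ k x, finrank ℝ (B (2 * k) x) < k → ∀ i, B (2 * k + i) x = B (2 * k) x := by
    intro k
    induction k with
    | zero => intro x hx; exact absurd hx (Nat.not_lt_zero _)
    | succ k ih =>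
      intro x hx
      have hev : ∀ᶠ y in 𝓝 x, B (2 * k + 1) y = B (2 * k) y := by
        filter_upwards [eventually_finrank_le (B (2 * k + 1)) x] with y hy
        rw [← hsucc] at hy
        by_cases hlt : finrank ℝ (B (2 * k) y) < k
        · exact ih y hlt 1
        · refine (Submodule.eq_of_le_of_finrank_le ?_ ?_).symm
          · rw [hsucc]; exact le_linearClosure _ _
          · have : 2 * (k + 1) = 2 * k + 1 + 1 := by ring
            rw [this] at hx
            lia
      have hall : ∀ i, ∀ᶠ y in 𝓝 x, B (2 * k + i) y = B (2 * k) y := by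
        intro i
        induction i with
        | zero => exact .of_forall fun y => rfl
        | succ i ihi =>
          filter_upwards [ihi.eventually_nhds, hev] with y hy hy1
          rw [← add_assoc, hsucc, linearClosure_congr hy, ← hsucc, hy1]
      intro i
      have h1 := (hall (2 + i)).self_of_nhds
      have h2 := (hall 2).self_of_nhds
      rw [← add_assoc] at h1
      rw [mul_add, mul_one, h1, h2]
  funext x
  rw [← Function.iterate_succ_apply' linearClosure]
  exact key _ x ((Submodule.finrank_le _).trans_lt (Nat.lt_succ_self _)) 1

end Bundles

section Paratangent

open Metric Set Filter Topology Module

variable {E : Type*} [NormedAddCommGroup E] [NormedSpace ℝ E]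

theorem exists_annihilator_near (T : Submodule ℝ E) (η : E →L[ℝ] ℝ) {ε : ℝ} (hε : 0 ≤ ε)
    (h : ∀ w ∈ T, |η w| ≤ ε * ‖w‖) :
    ∃ η' : E →L[ℝ] ℝ, (∀ w ∈ T, η' w = 0) ∧ dist η η' ≤ ε := by
  obtain ⟨ζ, hζ, hn⟩ := exists_extension_norm_eq T (η.comp T.subtypeL)
  refine ⟨η - ζ, fun w hw => ?_, ?_⟩
  · have : ζ w = η w := hζ ⟨w, hw⟩
    simp [this]
  · rw [dist_eq_norm, sub_sub_cancel, hn]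
    exact ContinuousLinearMap.opNorm_le_bound _ hε fun w => h w w.2

theorem isClosed_totalSpace {X : Type*} [TopologicalSpace X] {T : X → Submodule ℝ E}
    (hT : linearClosure T = T) : IsClosed (totalSpace T) := by
  refine isClosed_of_closure_subset fun q hq => ?_
  have : q.2 ∈ linearClosure T q.1 := Submodule.subset_span hq
  rwa [hT] at this

/-- The limits of multiples of chords of a set `A`, as a relation between base points and
vectors. -/
def chords (A : Set E) : Set ((E × E) × E) :=
  {q | q.1.1 ∈ A ∧ q.1.2 ∈ A ∧ ∃ t : ℝ, q.2 = t • (q.1.1 - q.1.2)}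

/-- The linear span of the paratangent cone of a set. -/
def paratangent (A : Set E) (p : E) : Submodule ℝ E :=
  Submodule.span ℝ {v | ((p, p), v) ∈ closure (chords A)}

/-- The Glaeser closure of the paratangent field. -/
noncomputable def paratangentClosure (A : Set E) : E → Submodule ℝ E :=
  linearClosure^[2 * (finrank ℝ E + 1)] (paratangent A)

theorem chords_smul {A : Set E} (q : E × E) (w : E) (h : (q, w) ∈ chords A) (t : ℝ) :
    (q, t • w) ∈ chords A := by
  obtain ⟨h1, h2, s, h3⟩ := h
  refine ⟨h1, h2, t * s, ?_⟩
  change w = _ at h3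
  change t • w = _
  rw [h3, smul_smul]

theorem fderiv_eq_zero_of_mem_iterate {A : Set E} {f : E → ℝ} (hf : ContDiff ℝ 1 f)
    (hfA : ∀ x ∈ A, f x = 0) (i : ℕ) (p v : E)
    (hv : v ∈ linearClosure^[i] (paratangent A) p) : fderiv ℝ f p v = 0 := by
  induction i generalizing p v with
  | zero =>
    have : paratangent A p ≤ (fderiv ℝ f p).ker := by
      refine Submodule.span_le.2 fun w hw => ?_
      change fderiv ℝ f p w = 0
      by_contra hne
      have hpos : 0 < |fderiv ℝ f p w| := abs_pos.2 hne
      obtain ⟨ε, hε, hεw⟩ : ∃ ε > 0, ε * ‖w‖ < |fderiv ℝ f p w| := by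
        refine ⟨|fderiv ℝ f p w| / (2 * (‖w‖ + 1)), by positivity, ?_⟩
        rw [div_mul_eq_mul_div, div_lt_iff₀ (by positivity)]
        nlinarith [norm_nonneg w]
      have hs := hasStrictFDerivAt_iff_isLittleO.1
        (hf.contDiffAt.hasStrictFDerivAt one_ne_zero : HasStrictFDerivAt f _ p)
      have h1 := Asymptotics.isLittleO_iff.1 hs hε
      rw [mem_ofPred_eq, mem_closure_iff_frequently] at hw
      have h2 : ∀ᶠ q : (E × E) × E in 𝓝 ((p, p), w),
          ‖f q.1.1 - f q.1.2 - fderiv ℝ f p (q.1.1 - q.1.2)‖ ≤ ε * ‖q.1.1 - q.1.2‖ :=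
        (continuous_fst.tendsto ((p, p), w)).eventually h1
      have h3 : ∀ᶠ q : (E × E) × E in 𝓝 ((p, p), w), ε * ‖q.2‖ < |fderiv ℝ f p q.2| := by
        have c1 : Continuous fun q : (E × E) × E => ε * ‖q.2‖ := by fun_prop
        have c2 : Continuous fun q : (E × E) × E => |fderiv ℝ f p q.2| := by fun_prop
        exact (isOpen_lt c1 c2).mem_nhds hεw
      obtain ⟨⟨⟨x, y⟩, u⟩, ⟨hx, hy, t, hu⟩, h4, h5⟩ := (hw.and_eventually (h2.and h3)).exists
      simp only at hx hy hu h4 h5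
      rw [hfA x hx, hfA y hy, sub_zero, zero_sub, norm_neg, Real.norm_eq_abs] at h4
      rw [hu, map_smul, smul_eq_mul, abs_mul, norm_smul, Real.norm_eq_abs] at h5
      nlinarith [abs_nonneg t]
    exact this hv
  | succ i ih =>
    rw [Function.iterate_succ_apply'] at hv
    have : linearClosure (linearClosure^[i] (paratangent A)) p ≤ (fderiv ℝ f p).ker := by
      refine Submodule.span_le.2 fun w hw => ?_
      have hc : IsClosed {q : E × E | fderiv ℝ f q.1 q.2 = 0} := by
        have h1 : Continuous (fderiv ℝ f) := hf.continuous_fderiv one_ne_zero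
        have h2 : Continuous fun q : E × E => fderiv ℝ f q.1 q.2 := by fun_prop
        exact isClosed_eq h2 continuous_const
      exact closure_minimal (fun q hq => ih q.1 q.2 hq) hc hw
    exact this hv

theorem paratangent_le_paratangentClosure (A : Set E) (x : E) :
    paratangent A x ≤ paratangentClosure A x := by
  have : ∀ i, paratangent A x ≤ linearClosure^[i] (paratangent A) x := by
    intro i
    induction i with
    | zero => exact le_rfl
    | succ i ih =>
      rw [Function.iterate_succ_apply']
      exact ih.trans (le_linearClosure _ _)
  exact this _

variable [FiniteDimensional ℝ E]

theorem exists_continuous_annihilator {T : E → Submodule ℝ E} (hT : IsClosed (totalSpace T))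
    (p : E) (ξ₀ : E →L[ℝ] ℝ) (hξ₀ : ∀ v ∈ T p, ξ₀ v = 0) :
    ∃ ξ : E → E →L[ℝ] ℝ, Continuous ξ ∧ ξ p = ξ₀ ∧ ∀ x, ∀ v ∈ T x, ξ x v = 0 := by
  set B : E → Set (E →L[ℝ] ℝ) := fun x => {η | (x = p → η = ξ₀) ∧ ∀ v ∈ T x, η v = 0} with hB
  suffices ∃ ξ, Continuous ξ ∧ ∀ x, ξ x ∈ B x by
    obtain ⟨ξ, hξ, hξB⟩ := this
    exact ⟨ξ, hξ, (hξB p).1 rfl, fun x => (hξB x).2⟩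
  refine exists_continuous_selection (fun x => ?_) (fun x => ?_) (fun x => ?_)
    (fun x η hη ε hε => ?_)
  · by_cases hx : x = p
    · exact ⟨ξ₀, fun _ => rfl, by rwa [hx]⟩
    · exact ⟨0, fun h => absurd h hx, fun v _ => rfl⟩
  · have : B x = (⋂ _ : x = p, {ξ₀}) ∩ ⋂ v ∈ T x, {η | η v = 0} := by
      ext η; simp [hB]
    rw [this]
    refine (isClosed_iInter fun _ => isClosed_singleton).inter
      (isClosed_biInter fun v _ => isClosed_eq ?_ continuous_const)
    exact (ContinuousLinearMap.apply ℝ ℝ v).continuous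
  · intro η hη η' hη' a b _ _ hab
    refine ⟨fun hx => ?_, fun v hv => ?_⟩
    · rw [hη.1 hx, hη'.1 hx, ← add_smul, hab, one_smul]
    · simp [hη.2 v hv, hη'.2 v hv]
  · have hev := eventually_abs_le_of_closure (W := totalSpace T) (p := x) (η := η)
      (fun y w hw t => (T y).smul_mem t hw)
      (fun v hv => by rw [hT.closure_eq] at hv; exact hη.2 v hv) (half_pos hε)
    have hnear : ∀ᶠ y in 𝓝 x, ∃ η' : E →L[ℝ] ℝ, (∀ w ∈ T y, η' w = 0) ∧ dist η η' < ε := by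
      filter_upwards [hev] with y hy
      obtain ⟨η', h1, h2⟩ := exists_annihilator_near (T y) η (half_pos hε).le hy
      exact ⟨η', h1, h2.trans_lt (half_lt_self hε)⟩
    by_cases hx : x = p
    · filter_upwards [hnear] with y ⟨η', h1, h2⟩
      by_cases hy : y = p
      · refine ⟨ξ₀, ⟨fun _ => rfl, by rwa [hy]⟩, ?_⟩
        rw [hη.1 hx, dist_self]
        exact hε
      · exact ⟨η', ⟨fun h => absurd h hy, h1⟩, h2⟩
    · filter_upwards [hnear, isOpen_ne.mem_nhds hx] with y ⟨η', h1, h2⟩ hy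
      exact ⟨η', ⟨fun h => absurd h hy, h1⟩, h2⟩

theorem linearClosure_paratangentClosure (A : Set E) :
    linearClosure (paratangentClosure A) = paratangentClosure A :=
  iterate_linearClosure_stable _

/-- A vector is tangent to every `C¹` function vanishing on a closed set if and only if it belongs
to the Glaeser closure of the paratangent field. -/
theorem mem_paratangentClosure_iff {A : Set E} (hA : IsClosed A) {p : E} (hp : p ∈ A) (v : E) :
    v ∈ paratangentClosure A p ↔
      ∀ f : E → ℝ, ContDiff ℝ 1 f → (∀ x ∈ A, f x = 0) → fderiv ℝ f p v = 0 := by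
  constructor
  · intro hv f hf hfA
    exact fderiv_eq_zero_of_mem_iterate hf hfA _ p v hv
  · intro h
    by_contra hv
    obtain ⟨φ, hφv, hφ⟩ := Submodule.exists_le_ker_of_notMem hv
    obtain ⟨ξ, hξc, hξp, hξ⟩ := exists_continuous_annihilator
      (isClosed_totalSpace (linearClosure_paratangentClosure A)) p φ.toContinuousLinearMap
      fun w hw => hφ hw
    obtain ⟨F, hF, hFA, hFd⟩ := whitney_extension hA ⟨p, hp⟩ ξ hξc (by
      intro q hq ε hε
      have hev := eventually_abs_le_of_closure (W := chords A) chords_smul (p := (q, q))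
        (η := ξ q) (fun w hw => hξ q w (paratangent_le_paratangentClosure A q
          (Submodule.subset_span hw))) hε
      obtain ⟨δ, hδ, hball⟩ := Metric.eventually_nhds_iff.1 hev
      refine ⟨δ, hδ, fun x hx y hy hxq hyq => hball (y := (x, y)) ?_ _ ⟨hx, hy, 1, ?_⟩⟩
      · rw [Prod.dist_eq, max_lt_iff, dist_eq_norm, dist_eq_norm]
        exact ⟨hxq, hyq⟩
      · simp)
    have := h F hF hFA
    rw [hFd p hp, hξp] at this
    exact hφv this

end Paratangent

section TangentDefinability

open Set

variable {S : RealStructure}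

/-- The distance of a coordinatized type is definable. -/
def DefDist (S : RealStructure) (α : Type) [Coord α] [PseudoMetricSpace α] : Prop :=
  DefSet S {q : (α × α) × ℝ | 0 < q.2 ∧ dist q.1.1 q.1.2 < q.2}

theorem defDist_pi (n : ℕ) : DefDist S (Fin n → ℝ) := by
  have h : DefSet S {q : ((Fin n → ℝ) × (Fin n → ℝ)) × ℝ |
      0 < q.2 ∧ ∀ i, |q.1.1 i - q.1.2 i| < q.2} :=
    DefSet.and (DefSet.lt (defMap_const 0) defMap_id.snd)
      (DefSet.ball defMap_id.fst.fst defMap_id.fst.snd defMap_id.snd)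
  refine RealStructure.mem_congr h fun x => ?_
  simp only [mem_preimage, mem_ofPred_eq]
  refine and_congr_right fun hpos => ?_
  rw [dist_pi_lt_iff hpos]
  simp only [Real.dist_eq]

theorem DefDist.prod {α β : Type} [Coord α] [Coord β] [PseudoMetricSpace α] [PseudoMetricSpace β]
    (hα : DefDist S α) (hβ : DefDist S β) : DefDist S (α × β) := by
  have h1 := ((defMap_id (α := ((α × β) × (α × β)) × ℝ)).fst.fst.fst.prodMk
    defMap_id.fst.snd.fst).prodMk defMap_id.snd |>.preimage hα
  have h2 := ((defMap_id (α := ((α × β) × (α × β)) × ℝ)).fst.fst.snd.prodMk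
    defMap_id.fst.snd.snd).prodMk defMap_id.snd |>.preimage hβ
  refine RealStructure.mem_congr (h1.and h2) fun x => ?_
  simp only [mem_preimage, mem_ofPred_eq, Prod.dist_eq, max_lt_iff]
  tauto

theorem DefSet.closure_of_dist {α : Type} [Coord α] [PseudoMetricSpace α] (hα : DefDist S α)
    {A : Set α} (hA : DefSet S A) : DefSet S (_root_.closure A) := by
  have h : DefSet S {x : α | ∀ ε : ℝ, 0 < ε → ∃ y, y ∈ A ∧ (0 < ε ∧ dist x y < ε)} :=
    DefSet.fa (P := fun (x : α) (ε : ℝ) => 0 < ε → ∃ y, y ∈ A ∧ (0 < ε ∧ dist x y < ε))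
      (DefSet.imp (DefSet.lt (defMap_const 0) defMap_id.snd)
      (DefSet.ex (P := fun (p : α × ℝ) y => y ∈ A ∧ (0 < p.2 ∧ dist p.1 y < p.2))
        (DefSet.and (defMap_id.snd.preimage hA)
        (((defMap_id (α := (α × ℝ) × α)).fst.fst.prodMk defMap_id.snd).prodMk
          defMap_id.fst.snd |>.preimage hα))))
  refine RealStructure.mem_congr h fun x => ?_
  simp only [mem_preimage, mem_ofPred_eq, Metric.mem_closure_iff]
  exact forall_congr' fun ε => forall_congr' fun hε => exists_congr fun y => by simp [hε]

theorem mem_span_pi_iff {n : ℕ} {W : Set (Fin n → ℝ)} {v : Fin n → ℝ} :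
    v ∈ Submodule.span ℝ W ↔
      ∀ c : Fin n → ℝ, (∀ w, w ∈ W → ∑ i, c i * w i = 0) → ∑ i, c i * v i = 0 := by
  constructor
  · intro hv c hc
    have : Submodule.span ℝ W ≤ (∑ i, c i • LinearMap.proj (R := ℝ) (φ := fun _ => ℝ) i).ker :=
      Submodule.span_le.2 fun w hw => by simpa using hc w hw
    simpa using this hv
  · intro h
    by_contra hv
    obtain ⟨φ, hφv, hφ⟩ := Submodule.exists_le_ker_of_notMem hv
    have hrep : ∀ w, ∑ i, φ (Pi.single i 1) * w i = φ w := by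
      intro w
      rw [LinearMap.pi_apply_eq_sum_univ φ w]
      refine Finset.sum_congr rfl fun i _ => ?_
      rw [smul_eq_mul, mul_comm]
      congr 2
      ext j
      simp [Pi.single_apply, eq_comm]
    refine hφv ?_
    rw [← hrep]
    refine h _ fun w hw => ?_
    rw [hrep]
    exact hφ (Submodule.subset_span hw)

theorem defSet_span {n : ℕ} {W : Set ((Fin n → ℝ) × (Fin n → ℝ))} (hW : DefSet S W) :
    DefSet S (totalSpace fun p : Fin n → ℝ => Submodule.span ℝ {v : Fin n → ℝ | (p, v) ∈ W}) := by
  have h : DefSet S {q : (Fin n → ℝ) × (Fin n → ℝ) | ∀ c : Fin n → ℝ,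
      (∀ w : Fin n → ℝ, (q.1, w) ∈ W → ∑ i, c i * w i = 0) → ∑ i, c i * q.2 i = 0} :=
    DefSet.fa (P := fun (q : (Fin n → ℝ) × (Fin n → ℝ)) (c : Fin n → ℝ) =>
      (∀ w : Fin n → ℝ, (q.1, w) ∈ W → ∑ i, c i * w i = 0) → ∑ i, c i * q.2 i = 0)
      (DefSet.imp
        (DefSet.fa (P := fun (q : ((Fin n → ℝ) × (Fin n → ℝ)) × (Fin n → ℝ)) (w : Fin n → ℝ) =>
          (q.1.1, w) ∈ W → ∑ i, q.2 i * w i = 0)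
          (DefSet.imp ((defMap_id.fst.fst.fst.prodMk defMap_id.snd).preimage hW)
            (DefSet.eq (DefMap.sum fun i => (defMap_id.fst.snd.apply i).mul
              (defMap_id.snd.apply i)) (defMap_const 0))))
        (DefSet.eq (DefMap.sum fun i => (defMap_id.snd.apply i).mul
              (defMap_id.fst.snd.apply i)) (defMap_const 0)))
  refine RealStructure.mem_congr h fun x => ?_
  exact mem_span_pi_iff

theorem defSet_linearClosure {n : ℕ} {H : (Fin n → ℝ) → Submodule ℝ (Fin n → ℝ)}
    (hH : DefSet S (totalSpace H)) : DefSet S (totalSpace (linearClosure H)) :=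
  defSet_span (DefSet.closure_of_dist ((defDist_pi n).prod (defDist_pi n)) hH)

theorem defSet_paratangent {n : ℕ} {A : Set (Fin n → ℝ)} (hA : DefSet S A) :
    DefSet S (totalSpace (paratangent A)) := by
  have hc : DefSet S (chords A) :=
    DefSet.and (defMap_id.fst.fst.preimage hA) (DefSet.and (defMap_id.fst.snd.preimage hA)
      (DefSet.ex (P := fun (q : ((Fin n → ℝ) × (Fin n → ℝ)) × (Fin n → ℝ)) (t : ℝ) =>
        q.2 = t • (q.1.1 - q.1.2))
        (DefSet.eq defMap_id.fst.snd (DefMap.pi fun i => defMap_id.snd.mul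
          ((defMap_id.fst.fst.fst.apply i).sub (defMap_id.fst.fst.snd.apply i))))))
  have hcl := DefSet.closure_of_dist
    (((defDist_pi n).prod (defDist_pi n)).prod (defDist_pi n)) hc
  exact defSet_span (W := {q | ((q.1, q.1), q.2) ∈ closure (chords A)})
    (((defMap_id.fst.prodMk defMap_id.fst).prodMk defMap_id.snd).preimage hcl)

theorem defSet_paratangentClosure {n : ℕ} {A : Set (Fin n → ℝ)} (hA : DefSet S A) :
    DefSet S (totalSpace (paratangentClosure A)) := by
  have : ∀ i, DefSet S (totalSpace (linearClosure^[i] (paratangent A))) := by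
    intro i
    induction i with
    | zero => exact defSet_paratangent hA
    | succ i ih =>
      rw [Function.iterate_succ_apply']
      exact defSet_linearClosure ih
  exact this _

theorem zariskiTangent_iff {n : ℕ} {A : Set (Fin n → ℝ)} {p : Fin n → ℝ} (hp : p ∈ A)
    (v : Fin n → ℝ) : ZariskiTangent A p v ↔ v ∈ paratangentClosure (closure A) p := by
  rw [mem_paratangentClosure_iff isClosed_closure (subset_closure hp)]
  refine forall_congr' fun f => forall_congr' fun hf => imp_congr_left ⟨fun h => ?_, fun h x hx =>
    h x (subset_closure hx)⟩
  intro x hx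
  exact closure_minimal (fun y hy => h y hy) (isClosed_eq hf.continuous continuous_const) hx

theorem defSet_charSet {n r : ℕ} {X : Fin r → (Fin n → ℝ) → (Fin n → ℝ)}
    (hX : ∀ j, DefinableFun S (X j)) {A : Set (Fin n → ℝ)} (hA : DefSet S A) :
    DefSet S (charSet X A) := by
  have hX' : ∀ j, DefMap S (X j) := hX
  have hcl : DefSet S (closure A) := hA.closure_of_dist (defDist_pi n)
  have h : DefSet S {p | p ∈ A ∧ ∀ j, (p, X j p) ∈ totalSpace (paratangentClosure (closure A))} :=
    DefSet.and hA (DefSet.all fun j =>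
      (defMap_id.prodMk (hX' j)).preimage (defSet_paratangentClosure hcl))
  refine RealStructure.mem_congr h fun x => ?_
  exact and_congr_right fun hx => forall_congr' fun j => zariskiTangent_iff hx _

theorem defSet_iterChar {n r : ℕ} {X : Fin r → (Fin n → ℝ) → (Fin n → ℝ)}
    (hX : ∀ j, DefinableFun S (X j)) {A : Set (Fin n → ℝ)} (hA : DefSet S A) (k : ℕ) :
    DefSet S (iterChar X A k) := by
  induction k with
  | zero => exact hA
  | succ k ih => exact defSet_charSet hX ih

end TangentDefinability

section Stabilization

open Set Topology

variable {n r : ℕ}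

theorem ZariskiTangent.mono_of_nhds {A B U : Set (Fin n → ℝ)} {p v : Fin n → ℝ}
    (h : ZariskiTangent A p v) (hU : U ∈ 𝓝 p) (hAB : A ∩ U ⊆ B) : ZariskiTangent B p v := by
  intro f hf hfB
  obtain ⟨ε, hε, hball⟩ := Metric.nhds_basis_closedBall.mem_iff.1 hU
  let χ : ContDiffBump p := ⟨ε / 2, ε, half_pos hε, half_lt_self hε⟩
  have h1 := h (fun x => χ x * f x) (χ.contDiff.mul hf) fun x hx => by
    by_cases hxU : x ∈ U
    · rw [hfB x (hAB ⟨hx, hxU⟩), mul_zero]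
    · rw [χ.zero_of_le_dist, zero_mul]
      by_contra! hlt
      exact hxU (hball hlt.le)
  have h2 : (fun x => χ x * f x) =ᶠ[𝓝 p] f := by
    filter_upwards [χ.eventuallyEq_one] with x hx
    rw [hx, Pi.one_apply, one_mul]
  rwa [h2.fderiv_eq] at h1

variable {X : Fin r → (Fin n → ℝ) → (Fin n → ℝ)}

theorem charSet_inter_congr {A B U : Set (Fin n → ℝ)} (hU : IsOpen U) (h : A ∩ U = B ∩ U) :
    charSet X A ∩ U = charSet X B ∩ U := by
  have key : ∀ {A B : Set (Fin n → ℝ)}, A ∩ U = B ∩ U → charSet X A ∩ U ⊆ charSet X B ∩ U := by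
    rintro A B h p ⟨⟨hp, ht⟩, hpU⟩
    have hsub : A ∩ U ⊆ B := h.trans_subset inter_subset_left
    exact ⟨⟨hsub ⟨hp, hpU⟩, fun j => (ht j).mono_of_nhds (hU.mem_nhds hpU) hsub⟩, hpU⟩
  exact (key h).antisymm (key h.symm)

theorem antitone_iterChar (E : Set (Fin n → ℝ)) : Antitone (iterChar X E) :=
  antitone_nat_of_succ_le fun _ _ hp => hp.1

theorem iterChar_add_inter {E U : Set (Fin n → ℝ)} (hU : IsOpen U) {i : ℕ}
    (h : iterChar X E i ∩ U = iterChar X E (i + 1) ∩ U) (j : ℕ) :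
    iterChar X E (i + j) ∩ U = iterChar X E i ∩ U := by
  induction j with
  | zero => rfl
  | succ j ih => exact (charSet_inter_congr hU ih).trans h.symm

/-- The points at which the chain of iterated characteristic sets may not have stabilized. -/
def unstable (X : Fin r → (Fin n → ℝ) → (Fin n → ℝ)) (E : Set (Fin n → ℝ)) : ℕ → Set (Fin n → ℝ)
  | 0 => univ
  | i + 1 => (unstable X E i ∩ iterChar X E (i + 1)) ∩
      closure (unstable X E i \ iterChar X E (i + 1))

theorem mem_iterChar_of_notMem_unstable (E : Set (Fin n → ℝ)) (i : ℕ) :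
    ∀ p ∉ unstable X E i, p ∈ iterChar X E i → ∀ j, p ∈ iterChar X E (i + j) := by
  induction i with
  | zero => intro p hp; exact absurd (mem_univ p) hp
  | succ i ih =>
    intro p hp hpE j
    have hpEi : p ∈ iterChar X E i := hpE.1
    have hij : i + 1 + j = i + (j + 1) := by ring
    rw [hij]
    by_cases hpi : p ∈ unstable X E i
    · set U := (closure (unstable X E i \ iterChar X E (i + 1)))ᶜ with hU
      have hUo : IsOpen U := isClosed_closure.isOpen_compl
      have hpU : p ∈ U := fun hcl => hp ⟨⟨hpi, hpE⟩, hcl⟩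
      have heq : iterChar X E i ∩ U = iterChar X E (i + 1) ∩ U := by
        refine Subset.antisymm (fun x hx => ⟨?_, hx.2⟩) fun x hx => ⟨hx.1.1, hx.2⟩
        by_cases hxi : x ∈ unstable X E i
        · by_contra hxE
          exact hx.2 (subset_closure ⟨hxi, hxE⟩)
        · exact ih x hxi hx.1 1
      have := iterChar_add_inter hUo heq (j + 1)
      exact (this.symm.subset ⟨hpEi, hpU⟩).1
    · exact ih p hpi hpEi _

theorem defSet_unstable {S : RealStructure} (hX : ∀ j, DefinableFun S (X j))
    {E : Set (Fin n → ℝ)} (hE : DefSet S E) (i : ℕ) : DefSet S (unstable X E i) := by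
  induction i with
  | zero => exact S.univ_mem n
  | succ i ih =>
    have h1 := defSet_iterChar hX hE (i + 1)
    exact DefSet.and (ih.and h1) (DefSet.closure (ih.and h1.not))

theorem dimLT_unstable {S : OMinimalStructure} (hX : ∀ j, DefinableFun S.toRealStructure (X j))
    {E : Set (Fin n → ℝ)} (hE : DefSet S.toRealStructure E) (i d : ℕ) (hid : i + d = n + 1) :
    DimLT d (unstable X E i) := by
  induction i generalizing d with
  | zero =>
    obtain rfl : d = n + 1 := by lia
    exact dimLT_succ _
  | succ i ih =>
    have hdef : DefSet S.toRealStructure (unstable X E i \ iterChar X E (i + 1)) :=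
      (defSet_unstable hX hE i).and (defSet_iterChar hX hE (i + 1)).not
    refine (DimLT.closure_diff hdef ((ih (d + 1) (by lia)).mono sdiff_subset)).mono ?_
    exact fun x hx => ⟨hx.2, fun h => h.2 hx.1.2⟩

end Stabilization

/-- Finite stabilization: for an o-minimal structure, definable vector
fields `X₁, …, X_r : ℝⁿ → ℝⁿ`, and a closed definable set `E ⊆ ℝⁿ`, the chain of
iterated characteristic sets stabilizes after at most `n + 1` steps. -/
theorem finite_stabilization (S : OMinimalStructure) {n r : ℕ}
    (X : Fin r → (Fin n → ℝ) → (Fin n → ℝ))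
    (hX : ∀ j, DefinableFun S.toRealStructure (X j))
    (E : Set (Fin n → ℝ)) (hEclosed : IsClosed E) (hE : E ∈ S.defin n) :
    ∃ k ≤ n + 1, ∀ m, k ≤ m → iterChar X E m = iterChar X E k := by
  refine ⟨n + 1, le_rfl, fun m hm => (antitone_iterChar E hm).antisymm fun p hp => ?_⟩
  obtain ⟨j, rfl⟩ := Nat.exists_eq_add_of_le hm
  refine mem_iterChar_of_notMem_unstable E (n + 1) p ?_ hp j
  rw [(dimLT_unstable hX hE (n + 1) 0 rfl).eq_empty]
  exact Set.notMem_empty p
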